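/- arXiv:1905.03366 — 3 statements merged into one kernel-verified Lean document; each statement's English description precedes it below -/
import Mathlib

section
/- With H = (Z/p)^s acting faithfully on the two-dimensional space V^# as above, the kH-module S^n(V^#) of degree-n polynomials is projective if and only if n ≡ -1 (mod p^s). -/
open MvPolynomial

/-- The `k`-algebra automorphism of `k[X,Y]` determined by `X ↦ X - cY`, `Y ↦ Y`
(we write `X = X 0`, `Y = X 1`). -/
noncomputable def substAct (k : Type*) [CommRing k] (c : k) :
    MvPolynomial (Fin 2) k →ₐ[k] MvPolynomial (Fin 2) k :=
  aeval (fun j => if j = 0 then X 0 - C c * X 1 else X 1)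

/-- Setting `Y = 1`, as a map to univariate polynomials. -/
noncomputable def dehomogenize (k : Type*) [CommRing k] :
    MvPolynomial (Fin 2) k →ₐ[k] Polynomial k :=
  aeval ![Polynomial.X, 1]

section Dehomogenize

variable {k : Type*} [CommRing k]

theorem dehomogenize_eq_sum (f : MvPolynomial (Fin 2) k) :
    dehomogenize k f =
      ∑ d ∈ f.support, Polynomial.C (coeff d f) * Polynomial.X ^ d 0 := by
  simp [dehomogenize, aeval_def, eval₂_eq', Fin.prod_univ_two, Polynomial.algebraMap_eq]

theorem dehomogenize_substAct (c : k) (f : MvPolynomial (Fin 2) k) :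
    dehomogenize k (substAct k c f) = Polynomial.taylor (-c) (dehomogenize k f) := by
  have h : (dehomogenize k).comp (substAct k c) =
      (Polynomial.taylorAlgHom (-c)).comp (dehomogenize k) := by
    ext j : 1
    fin_cases j <;>
      simp [dehomogenize, substAct, sub_eq_add_neg, Polynomial.algebraMap_eq,
        algHom_C]
  exact DFunLike.congr_fun h f

theorem degree_dehomogenize_lt {n : ℕ} {f : MvPolynomial (Fin 2) k}
    (hf : f.IsHomogeneous n) : (dehomogenize k f).degree < (n + 1 : ℕ) := by
  rw [dehomogenize_eq_sum, ← Polynomial.mem_degreeLT]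
  refine Submodule.sum_mem _ fun d hd => Polynomial.mem_degreeLT.2 ?_
  have h := (not_imp_comm.1 hf.coeff_eq_zero) (mem_support_iff.1 hd)
  refine (Polynomial.degree_C_mul_X_pow_le _ _).trans_lt ?_
  rw [Finsupp.degree_eq_sum, Fin.sum_univ_two] at h
  exact_mod_cast (by omega : d 0 < n + 1)

theorem coeff_dehomogenize {n : ℕ} {f : MvPolynomial (Fin 2) k} (hf : f.IsHomogeneous n)
    {d : Fin 2 →₀ ℕ} (hd : d.degree = n) :
    (dehomogenize k f).coeff (d 0) = coeff d f := by
  rw [dehomogenize_eq_sum, Polynomial.finsetSum_coeff, Finset.sum_eq_single d]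
  · simp
  · intro b hb hbd
    rw [Polynomial.coeff_C_mul_X_pow, if_neg]
    intro h0
    have hb' := (not_imp_comm.1 hf.coeff_eq_zero) (mem_support_iff.1 hb)
    rw [Finsupp.degree_eq_sum, Fin.sum_univ_two] at hb' hd
    refine hbd (Finsupp.ext fun j => ?_)
    fin_cases j
    · exact h0.symm
    · change b 1 = d 1
      omega
  · intro h
    simp [notMem_support_iff.1 h]

theorem eq_zero_of_dehomogenize_eq_zero {n : ℕ} {f : MvPolynomial (Fin 2) k}
    (hf : f.IsHomogeneous n) (h : dehomogenize k f = 0) : f = 0 := by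
  ext d
  by_cases hd : d.degree = n
  · rw [← coeff_dehomogenize hf hd, h]
    simp
  · rw [hf.coeff_eq_zero hd, coeff_zero]

theorem finrank_homogeneousSubmodule_fin_two [Nontrivial k] (n : ℕ) :
    Module.finrank k (homogeneousSubmodule (Fin 2) k n) = n + 1 := by
  have h : {d : Fin 2 →₀ ℕ | d.degree = n} =
      ((Finset.univ.finsuppAntidiag n : Finset (Fin 2 →₀ ℕ)) : Set (Fin 2 →₀ ℕ)) := by
    ext d
    simp [Finsupp.degree_eq_sum]
  rw [homogeneousSubmodule_eq_finsupp_supported, h,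
    (AddMonoidAlgebra.supportedEquivFinsupp _).finrank_eq, Module.finrank_finsupp_self]
  simp only [SetLike.coe_sort_coe, Fintype.card_coe]
  rw [Finset.card_finsuppAntidiag_nat_eq_choose]
  simp [Nat.add_comm 1 n]

end Dehomogenize

namespace Polynomial

variable {R : Type*} [CommRing R]

theorem add_divByMonic {q : R[X]} (hq : q.Monic) (f g : R[X]) :
    (f + g) /ₘ q = f /ₘ q + g /ₘ q := by
  nontriviality R
  refine (div_modByMonic_unique _ (f %ₘ q + g %ₘ q) hq ⟨?_, ?_⟩).1
  · linear_combination modByMonic_add_div f q + modByMonic_add_div g q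
  · exact (degree_add_le _ _).trans_lt
      (max_lt (degree_modByMonic_lt _ hq) (degree_modByMonic_lt _ hq))

theorem smul_divByMonic {q : R[X]} (hq : q.Monic) (c : R) (f : R[X]) :
    (c • f) /ₘ q = c • (f /ₘ q) := by
  nontriviality R
  refine (div_modByMonic_unique _ (c • (f %ₘ q)) hq ⟨?_, ?_⟩).1
  · simp only [smul_eq_C_mul]
    linear_combination C c * modByMonic_add_div f q
  · exact (degree_smul_le _ _).trans_lt (degree_modByMonic_lt _ hq)

theorem taylor_divByMonic {q : R[X]} (hq : q.Monic) {r : R} (hr : taylor r q = q) (f : R[X]) :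
    taylor r f /ₘ q = taylor r (f /ₘ q) := by
  nontriviality R
  refine (div_modByMonic_unique _ (taylor r (f %ₘ q)) hq ⟨?_, ?_⟩).1
  · conv_rhs => rw [← modByMonic_add_div f q, map_add, taylor_mul, hr]
  · rw [degree_taylor]
    exact degree_modByMonic_lt _ hq

/-- Evaluations at the points `v x` of the quotients of `f` by the powers of `q`. -/
noncomputable def evalDivPow {ι : Type*} {q : R[X]} (hq : q.Monic) (v : ι → R) (m : ℕ) :
    R[X] →ₗ[R] Fin m → ι → R where
  toFun f a x := (f /ₘ q ^ (a : ℕ)).eval (v x)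
  map_add' f g := by
    ext a x
    simp [add_divByMonic (hq.pow a)]
  map_smul' c f := by
    ext a x
    simp [smul_divByMonic (hq.pow a)]

theorem eq_zero_of_evalDivPow_eq_zero {K ι : Type*} [Field K] [Fintype ι] {v : ι → K}
    (hv : Function.Injective v) (hq : (∏ x, (X - C (v x))).Monic) {m : ℕ} {f : K[X]}
    (hf : f.degree < (m * Fintype.card ι : ℕ)) (h : evalDivPow hq v m f = 0) : f = 0 := by
  have hdvd : ∀ a ≤ m, (∏ x, (X - C (v x))) ^ a ∣ f := by
    intro a
    induction a with
    | zero => simp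
    | succ a ih =>
      intro ha
      obtain ⟨g, rfl⟩ := ih (by omega)
      rw [pow_succ]
      refine mul_dvd_mul_left _ (Fintype.prod_dvd_of_coprime ?_ fun x => ?_)
      · exact pairwise_coprime_X_sub_C hv
      · have hx := congrFun (congrFun h ⟨a, by omega⟩) x
        rw [dvd_iff_isRoot]
        simpa [evalDivPow, mul_divByMonic_cancel_left _ (hq.pow a)] using hx
  refine eq_zero_of_dvd_of_degree_lt (hdvd m le_rfl) (hf.trans_le ?_)
  simp [degree_prod]

end Polynomial

/-- The polynomial `∏ (X - v x)` attached to an additive map is invariant under translation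
by elements of the image. -/
theorem taylor_prod_X_sub_C {G k : Type*} [AddCommGroup G] [Fintype G] [CommRing k]
    (v : G →+ k) (y : G) :
    Polynomial.taylor (-v y) (∏ x, (Polynomial.X - Polynomial.C (v x))) =
      ∏ x, (Polynomial.X - Polynomial.C (v x)) := by
  change Polynomial.taylorAlgHom (-v y) _ = _
  rw [map_prod]
  refine Fintype.prod_equiv (Equiv.addRight y) _ _ fun x => ?_
  simp [sub_eq_add_neg, add_assoc, add_comm]

/-- The pairing `c ↦ ∑ cᵢ μᵢ`. -/
noncomputable def weightHom (p : ℕ) {k : Type*} [CommRing k] [CharP k p] {s : ℕ}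
    (μ : Fin s → k) : (Fin s → ZMod p) →+ k where
  toFun c := ∑ i, ZMod.castHom (dvd_refl p) k (c i) * μ i
  map_zero' := by simp
  map_add' c d := by simp only [Pi.add_apply, map_add, add_mul, Finset.sum_add_distrib]

theorem weightHom_single (p : ℕ) {k : Type*} [CommRing k] [CharP k p] {s : ℕ}
    (μ : Fin s → k) (i : Fin s) : weightHom p μ (Pi.single i 1) = μ i := by
  simp only [weightHom, AddMonoidHom.coe_mk, ZeroHom.coe_mk]
  rw [Finset.sum_eq_single i]
  · simp
  · intro j _ hj
    simp [Pi.single_eq_of_ne hj]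
  · simp

/-- With `H = (ℤ/p)^s` acting faithfully on the two-dimensional space `V^#`
as above (`gᵢ(Y) = Y`, `gᵢ(X) = X - μᵢY`, the `μᵢ` being `𝔽_p`-linearly independent), the
`kH`-module `Sⁿ(V^#)` of degree-`n` homogeneous polynomials is projective if and only if
`n ≡ -1 (mod p^s)`.

Since `kH` is a finite-dimensional local algebra, a module is projective if and only if it is
free; here projectivity is formalized as the existence of an `H`-equivariant `k`-linear
isomorphism with a direct sum of `m` copies of the regular representation
`kH = ((ℤ/p)^s → k)` (the `i`-th generator acting by translation by the `i`-th basis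
vector). -/
theorem symmetric_power_projective_iff (p : ℕ) [Fact p.Prime] (hp : Odd p)
    (k : Type*) [Field k] [CharP k p] (s : ℕ) (hs : 1 ≤ s) (μ : Fin s → k)
    (hμ : ∀ c : Fin s → ZMod p,
      ∑ i, ZMod.castHom (dvd_refl p) k (c i) * μ i = 0 → c = 0)
    (n : ℕ) :
    (∃ (m : ℕ) (e : homogeneousSubmodule (Fin 2) k n ≃ₗ[k]
        (Fin m → (Fin s → ZMod p) → k)),
      ∀ i : Fin s, ∀ f g : homogeneousSubmodule (Fin 2) k n,
        substAct k (μ i) (f : MvPolynomial (Fin 2) k) = (g : MvPolynomial (Fin 2) k) →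
          e g = fun a x => e f a (x - Pi.single i 1)) ↔ p ^ s ∣ n + 1 := by
  have hcard : Fintype.card (Fin s → ZMod p) = p ^ s := by simp [ZMod.card]
  constructor
  · rintro ⟨m, e, -⟩
    have h := e.finrank_eq
    rw [finrank_homogeneousSubmodule_fin_two, Module.finrank_pi_fintype] at h
    simp only [Module.finrank_fintype_fun_eq_card, hcard, Finset.sum_const, Finset.card_univ,
      Fintype.card_fin, smul_eq_mul] at h
    exact ⟨m, by rw [h, mul_comm]⟩
  · rintro ⟨m, hm⟩
    have hinj : Function.Injective (weightHom p μ) :=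
      (injective_iff_map_eq_zero _).2 hμ
    have hN := Polynomial.monic_prod_X_sub_C (weightHom p μ) Finset.univ
    let L : homogeneousSubmodule (Fin 2) k n →ₗ[k] (Fin m → (Fin s → ZMod p) → k) :=
      (Polynomial.evalDivPow hN (weightHom p μ) m ∘ₗ (dehomogenize k).toLinearMap) ∘ₗ
        (homogeneousSubmodule (Fin 2) k n).subtype
    have hL : Function.Injective L := by
      rw [← LinearMap.ker_eq_bot, LinearMap.ker_eq_bot']
      intro f hf
      refine Subtype.ext (eq_zero_of_dehomogenize_eq_zero f.2 ?_)
      refine Polynomial.eq_zero_of_evalDivPow_eq_zero hinj hN ?_ hf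
      rw [hcard, mul_comm, ← hm]
      exact degree_dehomogenize_lt f.2
    have hfin : Module.finrank k (homogeneousSubmodule (Fin 2) k n) =
        Module.finrank k (Fin m → (Fin s → ZMod p) → k) := by
      rw [finrank_homogeneousSubmodule_fin_two, Module.finrank_pi_fintype]
      simp only [Module.finrank_fintype_fun_eq_card, hcard, Finset.sum_const, Finset.card_univ,
        Fintype.card_fin, smul_eq_mul]
      rw [hm, mul_comm]
    have : FiniteDimensional k (homogeneousSubmodule (Fin 2) k n) :=
      Module.finite_of_finrank_pos (by rw [finrank_homogeneousSubmodule_fin_two]; omega)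
    refine ⟨m, L.linearEquivOfInjective hL hfin, fun i f g hfg => ?_⟩
    ext a x
    have hinv := taylor_prod_X_sub_C (weightHom p μ) (Pi.single i 1)
    rw [weightHom_single] at hinv
    simp only [LinearMap.linearEquivOfInjective_apply, L, LinearMap.comp_apply,
      Submodule.subtype_apply, AlgHom.toLinearMap_apply, ← hfg, dehomogenize_substAct,
      Polynomial.evalDivPow, LinearMap.coe_mk, AddHom.coe_mk]
    rw [Polynomial.taylor_divByMonic (hN.pow a) (by rw [Polynomial.taylor_pow, hinv]),
      Polynomial.taylor_eval, map_sub, weightHom_single, sub_eq_add_neg]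
end

section
/- Let A be a finite-dimensional k-algebra and M a p-dimensional module over a local unipotent-type algebra kH of dimension p^{r+s} (H = G_{a(r)} × (Z/p)^s-type truncated polynomial Hopf algebra) which is uniserial. Then there is a subalgebra A ⊆ kH of dimension p^{r+s-1} such that kH is flat (free) as an A-module, A acts trivially on M, and M ≅ kH ⊗_A k as kH-modules. -/
open MvPolynomial

set_option synthInstance.maxHeartbeats 1000000
set_option maxHeartbeats 1000000

/-- The truncated polynomial algebra `kH = k[u₁,…,u_m]/(u₁^p,…,u_m^p)`, the group algebra of
a finite unipotent abelian group scheme of the type `G_{a(r)} × (ℤ/p)^s` (`m = r + s`). -/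
noncomputable abbrev TruncAlg (k : Type) [Field k] (p m : ℕ) : Type :=
  MvPolynomial (Fin m) k ⧸ Ideal.span (Set.range fun i : Fin m => (X i : MvPolynomial (Fin m) k) ^ p)

namespace TruncAlg

variable (k : Type) [Field k] (p : ℕ)

/-- The class of the variable `uᵢ` in the truncated polynomial algebra. -/
noncomputable def gen (m : ℕ) (i : Fin m) : TruncAlg k p m :=
  Ideal.Quotient.mk _ (X i)

variable {k p}

lemma gen_pow {m : ℕ} (i : Fin m) : gen k p m i ^ p = 0 := by
  rw [gen, ← map_pow, Ideal.Quotient.eq_zero_iff_mem]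
  exact Ideal.subset_span ⟨i, rfl⟩

lemma algHom_ext {m : ℕ} {B : Type*} [Semiring B] [Algebra k B] {f g : TruncAlg k p m →ₐ[k] B}
    (h : ∀ i, f (gen k p m i) = g (gen k p m i)) : f = g :=
  Ideal.Quotient.algHom_ext k (MvPolynomial.algHom_ext h)

/-- The algebra map out of the truncated polynomial algebra sending `uᵢ` to `b i`. -/
noncomputable def lift {m : ℕ} {B : Type*} [CommRing B] [Algebra k B] (b : Fin m → B)
    (hb : ∀ i, b i ^ p = 0) : TruncAlg k p m →ₐ[k] B :=
  Ideal.Quotient.liftₐ _ (MvPolynomial.aeval b) (fun a ha => by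
    have hle : Ideal.span (Set.range fun i : Fin m => (X i : MvPolynomial (Fin m) k) ^ p) ≤
        RingHom.ker (MvPolynomial.aeval b : MvPolynomial (Fin m) k →ₐ[k] B) := by
      rw [Ideal.span_le]
      rintro _ ⟨i, rfl⟩
      simp [RingHom.mem_ker, hb]
    exact hle ha)

lemma lift_gen {m : ℕ} {B : Type*} [CommRing B] [Algebra k B] (b : Fin m → B)
    (hb : ∀ i, b i ^ p = 0) (i : Fin m) : lift b hb (gen k p m i) = b i :=
  (Ideal.Quotient.lift_mk _ _ _).trans (MvPolynomial.aeval_X b i)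

lemma adjoin_range_gen (m : ℕ) : Algebra.adjoin k (Set.range (gen k p m)) = ⊤ := by
  have h : Set.range (gen k p m) =
      Ideal.Quotient.mkₐ k (Ideal.span (Set.range fun i : Fin m =>
        (X i : MvPolynomial (Fin m) k) ^ p)) '' Set.range X := by
    rw [← Set.range_comp]; rfl
  rw [h, ← AlgHom.map_adjoin, MvPolynomial.adjoin_range_X, Algebra.map_top,
    AlgHom.range_eq_top]
  exact Ideal.Quotient.mkₐ_surjective _ _

/-- The elements `uⱼ - uᵢ hⱼ(uᵢ)` for `j ≠ i`. -/
noncomputable def shift {n : ℕ} (i : Fin (n + 1)) (h : Fin n → Polynomial k) (j : Fin n) :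
    TruncAlg k p (n + 1) :=
  gen k p (n + 1) (i.succAbove j) -
    gen k p (n + 1) i * Polynomial.aeval (gen k p (n + 1) i) (h j)

/-- Killing the elements `uⱼ - uᵢ hⱼ(uᵢ)` leaves a quotient of `k[uᵢ]/(uᵢ^p)`. -/
theorem finrank_quotient_le {n : ℕ} (i : Fin (n + 1)) (h : Fin n → Polynomial k) :
    Module.Finite k (TruncAlg k p (n + 1) ⧸ Ideal.span (Set.range (shift (p := p) i h))) ∧
    Module.finrank k (TruncAlg k p (n + 1) ⧸ Ideal.span (Set.range (shift (p := p) i h))) ≤ p := by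
  let π := Ideal.Quotient.mkₐ k (Ideal.span (Set.range (shift (p := p) i h)))
  let g : AdjoinRoot ((Polynomial.X : Polynomial k) ^ p) →ₐ[k]
      TruncAlg k p (n + 1) ⧸ Ideal.span (Set.range (shift (p := p) i h)) :=
    AdjoinRoot.liftAlgHom _ (Algebra.ofId k _) (π (gen k p (n + 1) i))
      (by simp [← map_pow, gen_pow])
  have hroot : g (AdjoinRoot.root _) = π (gen k p (n + 1) i) :=
    AdjoinRoot.liftAlgHom_root _ _ _ _
  have hgen : ∀ l, π (gen k p (n + 1) l) ∈ g.range := by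
    intro l
    induction l using Fin.succAboveCases i with
    | x => exact ⟨_, hroot⟩
    | p j =>
      have hj : π (shift i h j) = 0 :=
        Ideal.Quotient.eq_zero_iff_mem.mpr (Ideal.subset_span ⟨j, rfl⟩)
      rw [shift, map_sub, sub_eq_zero] at hj
      rw [hj, map_mul, ← Polynomial.aeval_algHom_apply, ← hroot, Polynomial.aeval_algHom_apply,
        ← map_mul]
      exact ⟨_, rfl⟩
  have hsurj : Function.Surjective g := by
    rw [← AlgHom.range_eq_top, eq_top_iff, ← (AlgHom.range_eq_top π).mpr
      (Ideal.Quotient.mkₐ_surjective k _), ← Algebra.map_top, ← adjoin_range_gen,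
      AlgHom.map_adjoin, Algebra.adjoin_le_iff]
    rintro _ ⟨_, ⟨l, rfl⟩, rfl⟩
    exact hgen l
  have hmonic : ((Polynomial.X : Polynomial k) ^ p).Monic := Polynomial.monic_X_pow p
  have := hmonic.finite_adjoinRoot
  refine ⟨Module.Finite.of_surjective g.toLinearMap hsurj, ?_⟩
  refine (LinearMap.finrank_le_finrank_of_surjective (f := g.toLinearMap) hsurj).trans ?_
  rw [(AdjoinRoot.powerBasis' hmonic).finrank, AdjoinRoot.powerBasis'_dim,
    Polynomial.natDegree_X_pow]

/-- If all `uⱼ` map `M` into a submodule `P`, then scalars act on `M / P` through `k`. -/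
lemma exists_smul_sub_mem {m : ℕ} {M : Type*} [AddCommGroup M] [Module (TruncAlg k p m) M]
    [Module k M] [IsScalarTower k (TruncAlg k p m) M] {P : Submodule (TruncAlg k p m) M}
    (hP : ∀ j, ∀ y : M, gen k p m j • y ∈ P) (r : TruncAlg k p m) (x : M) :
    ∃ c : k, r • x - c • x ∈ P := by
  obtain ⟨q, rfl⟩ := Ideal.Quotient.mk_surjective r
  induction q using MvPolynomial.induction_on with
  | C a =>
    refine ⟨a, ?_⟩
    have : (Ideal.Quotient.mk (Ideal.span (Set.range fun i : Fin m =>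
        (X i : MvPolynomial (Fin m) k) ^ p)) (C a)) = algebraMap k (TruncAlg k p m) a := rfl
    rw [this, algebraMap_smul, sub_self]
    exact P.zero_mem
  | add q₁ q₂ h₁ h₂ =>
    obtain ⟨c₁, h₁⟩ := h₁
    obtain ⟨c₂, h₂⟩ := h₂
    refine ⟨c₁ + c₂, ?_⟩
    rw [map_add, add_smul, add_smul, add_sub_add_comm]
    exact P.add_mem h₁ h₂
  | mul_X q j _ =>
    refine ⟨0, ?_⟩
    rw [map_mul, mul_comm, mul_smul, zero_smul, sub_zero]
    exact hP j _

/-- A finitely generated uniserial module is cyclic. -/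
lemma exists_span_singleton_eq_top {R M : Type*} [Ring R] [AddCommGroup M] [Module R M]
    [IsNoetherian R M] (huni : ∀ N N' : Submodule R M, N ≤ N' ∨ N' ≤ N) :
    ∃ x : M, Submodule.span R {x} = ⊤ := by
  obtain ⟨_, ⟨x, rfl⟩, hx⟩ := set_has_maximal_iff_noetherian.mpr ‹IsNoetherian R M›
    (Set.range fun x : M => Submodule.span R {x}) (Set.range_nonempty _)
  refine ⟨x, eq_top_iff.mpr fun y _ => ?_⟩
  have hy : Submodule.span R {y} ≤ Submodule.span R {x} := by
    rcases huni (Submodule.span R {y}) (Submodule.span R {x}) with h | h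
    · exact h
    · exact (eq_of_le_of_not_lt h (hx _ ⟨y, rfl⟩)).ge
  exact hy (Submodule.mem_span_singleton_self y)

/-- If `x` generates a module on which some `uᵢ` has the largest image among all `uⱼ`, then `x`
generates it over `k[uᵢ]`. -/
lemma exists_aeval_smul_eq {m : ℕ} {M : Type*} [AddCommGroup M] [Module (TruncAlg k p m) M]
    [Module k M] [IsScalarTower k (TruncAlg k p m) M] {x : M}
    (hx : Submodule.span (TruncAlg k p m) {x} = ⊤) {i : Fin m}
    (hi : ∀ j, LinearMap.range (LinearMap.lsmul (TruncAlg k p m) M (gen k p m j)) ≤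
      LinearMap.range (LinearMap.lsmul (TruncAlg k p m) M (gen k p m i))) (y : M) :
    ∃ f : Polynomial k, y = Polynomial.aeval (gen k p m i) f • x := by
  have hstep : ∀ y : M, ∃ (c : k) (z : M), y = c • x + gen k p m i • z := by
    intro y
    obtain ⟨r, rfl⟩ := Submodule.mem_span_singleton.mp (hx ▸ Submodule.mem_top : y ∈ _)
    obtain ⟨c, z, hz⟩ := exists_smul_sub_mem (fun j y => hi j ⟨y, rfl⟩) r x
    exact ⟨c, z, (sub_eq_iff_eq_add'.mp hz.symm)⟩
  have hzero : ∀ z : M, (0 : TruncAlg k p m) • z = 0 := Module.zero_smul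
  have hpow : ∀ n : ℕ, ∃ (f : Polynomial k) (z : M),
      y = Polynomial.aeval (gen k p m i) f • x + gen k p m i ^ n • z := by
    intro n
    induction n with
    | zero => exact ⟨0, y, by simp [hzero]⟩
    | succ n ih =>
      obtain ⟨f, z, hz⟩ := ih
      obtain ⟨c, z', hz'⟩ := hstep z
      refine ⟨f + Polynomial.C c * Polynomial.X ^ n, z', ?_⟩
      rw [hz, hz', map_add, map_mul, map_pow, Polynomial.aeval_X, Polynomial.aeval_C, add_smul,
        mul_comm, mul_smul, algebraMap_smul, smul_add, smul_smul, pow_succ, add_assoc]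
  obtain ⟨f, z, hz⟩ := hpow p
  exact ⟨f, by rw [hz, gen_pow, hzero, add_zero]⟩

variable [Fact p.Prime] [CharP k p]

lemma shift_pow {n : ℕ} (i : Fin (n + 1)) (h : Fin n → Polynomial k) (j : Fin n) :
    (shift i h j : TruncAlg k p (n + 1)) ^ p = 0 := by
  by_cases hR : Nontrivial (TruncAlg k p (n + 1))
  · have : CharP (TruncAlg k p (n + 1)) p := charP_of_injective_algebraMap' k p
    rw [shift, sub_pow_char, mul_pow, gen_pow, gen_pow, zero_mul, sub_zero]
  · rw [not_nontrivial_iff_subsingleton] at hR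
    exact Subsingleton.elim _ _

/-- The truncated polynomial algebra in `n + 1` variables is `B[T]/(T^p)`, where `B` is the
truncated polynomial algebra in `n` variables, with `T` corresponding to `uᵢ` and the variables
of `B` to the elements `uⱼ - uᵢ hⱼ(uᵢ)`. -/
theorem exists_algEquiv_adjoinRoot {n : ℕ} (i : Fin (n + 1)) (h : Fin n → Polynomial k) :
    ∃ e : AdjoinRoot ((Polynomial.X : Polynomial (TruncAlg k p n)) ^ p) ≃ₐ[k]
        TruncAlg k p (n + 1),
      ∀ j, e (AdjoinRoot.of _ (gen k p n j)) = shift i h j := by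
  have hr : AdjoinRoot.root ((Polynomial.X : Polynomial (TruncAlg k p n)) ^ p) ^ p = 0 := by
    have := AdjoinRoot.eval₂_root ((Polynomial.X : Polynomial (TruncAlg k p n)) ^ p)
    simpa using this
  set r := AdjoinRoot.root ((Polynomial.X : Polynomial (TruncAlg k p n)) ^ p) with hr_def
  let Q := AdjoinRoot ((Polynomial.X : Polynomial (TruncAlg k p n)) ^ p)
  let φ : TruncAlg k p n →ₐ[k] TruncAlg k p (n + 1) := lift (shift i h) (shift_pow i h)
  let F : Q →ₐ[k] TruncAlg k p (n + 1) :=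
    AdjoinRoot.liftAlgHom _ φ (gen k p (n + 1) i) (by simp [gen_pow])
  have hFof : ∀ b, F (AdjoinRoot.of _ b) = φ b := fun b => AdjoinRoot.liftAlgHom_of _ _ _ _ _
  have hFr : F r = gen k p (n + 1) i := AdjoinRoot.liftAlgHom_root _ _ _ _
  let c : Fin (n + 1) → Q :=
    i.insertNth r (fun j => AdjoinRoot.of _ (gen k p n j) + r * Polynomial.aeval r (h j))
  have hc : ∀ l, c l ^ p = 0 := by
    intro l
    by_cases hQ : Nontrivial Q
    · have : CharP Q p := charP_of_injective_algebraMap' k p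
      induction l using Fin.succAboveCases i with
      | x => simpa [c] using hr
      | p j =>
        simp only [c, Fin.insertNth_apply_succAbove]
        rw [add_pow_char, mul_pow, hr, zero_mul, add_zero, ← map_pow, gen_pow, map_zero]
    · rw [not_nontrivial_iff_subsingleton] at hQ
      exact Subsingleton.elim _ _
  let G : TruncAlg k p (n + 1) →ₐ[k] Q := lift c hc
  have hGi : G (gen k p (n + 1) i) = r := by simp [G, lift_gen, c]
  have hGj : ∀ j, G (gen k p (n + 1) (i.succAbove j)) =
      AdjoinRoot.of _ (gen k p n j) + r * Polynomial.aeval r (h j) := by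
    intro j; simp [G, lift_gen, c]
  have hFG : F.comp G = AlgHom.id k _ := by
    refine algHom_ext fun l => ?_
    induction l using Fin.succAboveCases i with
    | x => simp [hGi, hFr]
    | p j =>
      simp only [AlgHom.comp_apply, hGj, map_add, map_mul, hFof, hFr, φ, lift_gen,
        ← Polynomial.aeval_algHom_apply, shift, AlgHom.id_apply]
      ring
  have hGF : G.comp F = AlgHom.id k _ := by
    have hof : (G.comp φ) = (AdjoinRoot.ofAlgHom k
        ((Polynomial.X : Polynomial (TruncAlg k p n)) ^ p)) := by
      refine algHom_ext fun j => ?_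
      simp only [AlgHom.comp_apply, φ, lift_gen, shift, map_sub, map_mul, hGj, hGi,
        ← Polynomial.aeval_algHom_apply, add_sub_cancel_right]
      rfl
    refine AdjoinRoot.algHom_ext' ?_ ?_
    · ext b
      · exact (congrArg G (hFof _)).trans (DFunLike.congr_fun hof _)
    · exact (congrArg G hFr).trans hGi
  exact ⟨AlgEquiv.ofAlgHom F G hFG hGF, fun j => (hFof _).trans (lift_gen _ _ j)⟩

theorem finrank_eq (n : ℕ) : Module.finrank k (TruncAlg k p n) = p ^ n := by
  induction n with
  | zero =>
    let e : TruncAlg k p 0 ≃ₐ[k] k := AlgEquiv.ofAlgHom (lift Fin.elim0 fun i => i.elim0)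
      (Algebra.ofId k _) (by ext) (algHom_ext fun i => i.elim0)
    rw [e.toLinearEquiv.finrank_eq, Module.finrank_self, pow_zero]
  | succ n ih =>
    have : Nontrivial (TruncAlg k p n) := Module.nontrivial_of_finrank_pos (R := k)
      (by rw [ih]; exact pow_pos (Fact.out : p.Prime).pos n)
    obtain ⟨e, -⟩ := exists_algEquiv_adjoinRoot (p := p) (0 : Fin (n + 1))
      (0 : Fin n → Polynomial k)
    have hmonic : ((Polynomial.X : Polynomial (TruncAlg k p n)) ^ p).Monic :=
      Polynomial.monic_X_pow p
    have := hmonic.free_adjoinRoot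
    rw [← e.toLinearEquiv.finrank_eq, ← Module.finrank_mul_finrank k (TruncAlg k p n), ih,
      (AdjoinRoot.powerBasis' hmonic).finrank, AdjoinRoot.powerBasis'_dim,
      Polynomial.natDegree_X_pow, pow_succ]

instance (n : ℕ) : Nontrivial (TruncAlg k p n) :=
  Module.nontrivial_of_finrank_pos (R := k)
    (by rw [finrank_eq]; exact pow_pos (Fact.out : p.Prime).pos n)

/-- The subalgebra generated by the `uⱼ - uᵢ hⱼ(uᵢ)` is a truncated polynomial algebra in `n`
variables, over which the truncated polynomial algebra in `n + 1` variables is flat. -/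
theorem finrank_adjoin_shift_and_flat {n : ℕ} (i : Fin (n + 1)) (h : Fin n → Polynomial k) :
    Module.finrank k (Algebra.adjoin k (Set.range (shift (p := p) i h))) = p ^ n ∧
    Module.Flat (Algebra.adjoin k (Set.range (shift (p := p) i h))) (TruncAlg k p (n + 1)) := by
  obtain ⟨e, he⟩ := exists_algEquiv_adjoinRoot (p := p) i h
  have hmonic : ((Polynomial.X : Polynomial (TruncAlg k p n)) ^ p).Monic :=
    Polynomial.monic_X_pow p
  have := hmonic.free_adjoinRoot
  have := e.toRingEquiv.nontrivial
  let ψ : TruncAlg k p n →ₐ[k] TruncAlg k p (n + 1) := e.toAlgHom.comp (AdjoinRoot.ofAlgHom k _)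
  have hψ : Function.Injective ψ :=
    e.injective.comp (FaithfulSMul.algebraMap_injective (TruncAlg k p n) _)
  have hflat : (ψ : TruncAlg k p n →+* TruncAlg k p (n + 1)).Flat := by
    have hcomp : (ψ : TruncAlg k p n →+* TruncAlg k p (n + 1)) =
        (e : AdjoinRoot ((Polynomial.X : Polynomial (TruncAlg k p n)) ^ p) →+*
          TruncAlg k p (n + 1)).comp (algebraMap (TruncAlg k p n) _) := rfl
    rw [hcomp]
    exact RingHom.Flat.comp (RingHom.flat_algebraMap_iff.mpr inferInstance)
      (RingHom.Flat.of_bijective e.bijective)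
  have hrange : Algebra.adjoin k (Set.range (shift (p := p) i h)) = ψ.range := by
    rw [← Algebra.map_top, ← adjoin_range_gen, AlgHom.map_adjoin, ← Set.range_comp]
    exact congrArg (fun f => Algebra.adjoin k (Set.range f)) (funext fun j => (he j).symm)
  rw [hrange]
  let ε := AlgEquiv.ofInjective ψ hψ
  refine ⟨by rw [← ε.toLinearEquiv.finrank_eq, finrank_eq], ?_⟩
  refine (RingHom.flat_algebraMap_iff (R := ψ.range) (S := TruncAlg k p (n + 1))).mp ?_
  have hcomp : algebraMap ψ.range (TruncAlg k p (n + 1)) =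
      (ψ : TruncAlg k p n →+* TruncAlg k p (n + 1)).comp (ε.symm : ψ.range →+* _) := by
    ext a
    obtain ⟨b, rfl⟩ := ε.surjective a
    simp [ε]
  rw [hcomp]
  exact RingHom.Flat.comp (RingHom.Flat.of_bijective ε.symm.bijective) hflat

end TruncAlg

/-- Let `kH = k[u₁,…,u_{r+s}]/(uᵢ^p)` be a truncated polynomial algebra of
dimension `p^{r+s}` over a field `k` of characteristic `p`, and let `M` be a `p`-dimensional
uniserial `kH`-module.  Then there is a subalgebra `A ⊆ kH` of dimension `p^{r+s-1}`,
generated by `r+s-1` elements `w₁,…,w_{r+s-1}` annihilating `M`, such that `kH` is flat over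
`A`, `A` acts trivially on `M`, and `M ≅ kH ⊗_A k` as `kH`-modules (equivalently, since the
`wⱼ` generate the augmentation ideal of `A`, `M ≅ kH/(w₁,…,w_{r+s-1})`). -/
theorem uniserial_induced_from_subalgebra (p : ℕ) [Fact p.Prime] (hp : Odd p)
    (k : Type) [Field k] [CharP k p] (m : ℕ) (hm : 1 ≤ m)
    (M : Type) [AddCommGroup M] [Module (TruncAlg k p m) M]
    [Module k M] [IsScalarTower k (TruncAlg k p m) M]
    (hdim : Module.finrank k M = p)
    (huni : ∀ N N' : Submodule (TruncAlg k p m) M, N ≤ N' ∨ N' ≤ N) :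
    ∃ w : Fin (m - 1) → TruncAlg k p m,
      Module.finrank k (Algebra.adjoin k (Set.range w)) = p ^ (m - 1) ∧
      Module.Flat (Algebra.adjoin k (Set.range w)) (TruncAlg k p m) ∧
      (∀ j : Fin (m - 1), ∀ x : M, w j • x = 0) ∧
      Nonempty (M ≃ₗ[TruncAlg k p m]
        (TruncAlg k p m ⧸ Ideal.span (Set.range w))) := by
  obtain ⟨n, rfl⟩ : ∃ n, m = n + 1 := ⟨m - 1, by omega⟩
  have hp0 : 0 < p := (Fact.out : p.Prime).pos
  have : Module.Finite k M := Module.finite_of_finrank_pos (by rw [hdim]; exact hp0)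
  have : Module.Finite (TruncAlg k p (n + 1)) M := Module.Finite.of_restrictScalars_finite k _ M
  obtain ⟨x, hx⟩ := TruncAlg.exists_span_singleton_eq_top huni
  obtain ⟨i, hi⟩ : ∃ i, ∀ j,
      LinearMap.range (LinearMap.lsmul (TruncAlg k p (n + 1)) M (TruncAlg.gen k p (n + 1) j)) ≤
      LinearMap.range (LinearMap.lsmul (TruncAlg k p (n + 1)) M (TruncAlg.gen k p (n + 1) i)) :=
    Directed.finite_le (r := (· ≤ ·)) (f := fun i => LinearMap.range
      (LinearMap.lsmul (TruncAlg k p (n + 1)) M (TruncAlg.gen k p (n + 1) i)))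
      (fun a b => (huni _ _).elim (fun h => ⟨b, h, le_rfl⟩) fun h => ⟨a, le_rfl, h⟩) id
  have hh : ∀ j : Fin n, ∃ h : Polynomial k, TruncAlg.gen k p (n + 1) (i.succAbove j) • x =
      (TruncAlg.gen k p (n + 1) i * Polynomial.aeval (TruncAlg.gen k p (n + 1) i) h) • x := by
    intro j
    obtain ⟨y, hy⟩ := hi (i.succAbove j) ⟨x, rfl⟩
    obtain ⟨f, rfl⟩ := TruncAlg.exists_aeval_smul_eq hx hi y
    exact ⟨f, by rw [mul_smul]; exact hy.symm⟩
  choose h hh using hh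
  have hwx : ∀ j, (TruncAlg.shift i h j : TruncAlg k p (n + 1)) • x = 0 := fun j => by
    rw [TruncAlg.shift, sub_smul, hh, sub_self]
  obtain ⟨hrank, hflat⟩ := TruncAlg.finrank_adjoin_shift_and_flat (p := p) i h
  obtain ⟨hfin, hle⟩ := TruncAlg.finrank_quotient_le (p := p) i h
  refine ⟨TruncAlg.shift i h, hrank, hflat, fun j y => ?_, ?_⟩
  · obtain ⟨r, rfl⟩ := Submodule.mem_span_singleton.mp (hx ▸ Submodule.mem_top : y ∈ _)
    rw [smul_comm]
    exact (congrArg (r • ·) (hwx j)).trans (smul_zero r)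
  · let φ : (TruncAlg k p (n + 1) ⧸ Ideal.span (Set.range (TruncAlg.shift (p := p) i h)))
        →ₗ[TruncAlg k p (n + 1)] M :=
      Submodule.liftQ _ (LinearMap.toSpanSingleton (TruncAlg k p (n + 1)) M x)
        (Submodule.span_le.mpr (by
        rintro _ ⟨j, rfl⟩
        exact hwx j))
    have hsurj : Function.Surjective φ := by
      intro y
      obtain ⟨r, rfl⟩ := Submodule.mem_span_singleton.mp (hx ▸ Submodule.mem_top : y ∈ _)
      exact ⟨Submodule.Quotient.mk r, rfl⟩
    have hinj : Function.Injective φ := by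
      have heq := le_antisymm (hle.trans hdim.ge)
        (LinearMap.finrank_le_finrank_of_surjective (f := φ.restrictScalars k) hsurj)
      exact (LinearMap.injective_iff_surjective_of_finrank_eq_finrank
        (f := φ.restrictScalars k) heq).mpr hsurj
    exact ⟨(LinearEquiv.ofBijective φ ⟨hinj, hsurj⟩).symm⟩
end

section
/- Let k be a field of odd characteristic p and let A = k[u,v,t]/(u²,v²,uv+vu,t^p,tv-vt,tu-ut-v) be the group algebra of G = (G_a⁻ × G_a⁻) ⋊ G_{a(1)}. Then the Poincaré series of the cohomology of G satisfies ∑_n dim_k H^{n,*}(G,k) t^n = 1/(1-t)², i.e., dim_k H^n(A,k) = n+1 for all n ≥ 0. -/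
open CategoryTheory

/-- Relations defining `kG = k[u,v,t]/(u², v², uv+vu, t^p, tv-vt, tu-ut-v)` for
`G = (G_a⁻ × G_a⁻) ⋊ G_{a(1)}`; here `u = ι 0`, `v = ι 1`, `t = ι 2`. -/
inductive SuperRel (k : Type) [Field k] (p : ℕ) :
    FreeAlgebra k (Fin 3) → FreeAlgebra k (Fin 3) → Prop
  | uu : SuperRel k p (FreeAlgebra.ι k 0 * FreeAlgebra.ι k 0) 0
  | vv : SuperRel k p (FreeAlgebra.ι k 1 * FreeAlgebra.ι k 1) 0
  | uv : SuperRel k p (FreeAlgebra.ι k 0 * FreeAlgebra.ι k 1)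
      (-(FreeAlgebra.ι k 1 * FreeAlgebra.ι k 0))
  | tp : SuperRel k p ((FreeAlgebra.ι k 2) ^ p) 0
  | tv : SuperRel k p (FreeAlgebra.ι k 2 * FreeAlgebra.ι k 1)
      (FreeAlgebra.ι k 1 * FreeAlgebra.ι k 2)
  | tu : SuperRel k p (FreeAlgebra.ι k 2 * FreeAlgebra.ι k 0)
      (FreeAlgebra.ι k 0 * FreeAlgebra.ι k 2 + FreeAlgebra.ι k 1)

/-- The group algebra `kG` of `G = (G_a⁻ × G_a⁻) ⋊ G_{a(1)}`. -/
noncomputable abbrev SuperAlg (k : Type) [Field k] (p : ℕ) : Type :=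
  RingQuot (SuperRel k p)

/-- The augmentation `kG → k`, `u, v, t ↦ 0`, giving the trivial module `k`. -/
noncomputable def superAug (k : Type) [Field k] (p : ℕ) [Fact p.Prime] : SuperAlg k p →ₐ[k] k :=
  RingQuot.liftAlgHom k
    ⟨FreeAlgebra.lift k (fun _ => (0 : k)), by
      intro x y h
      induction h <;> simp [FreeAlgebra.lift_ι_apply, (Fact.out : p.Prime).ne_zero]⟩

/-- `k` as the trivial `kG`-module. -/
noncomputable instance (k : Type) [Field k] (p : ℕ) [Fact p.Prime] : Module (SuperAlg k p) k :=
  Module.compHom k (superAug k p).toRingHom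

/-- Elements `u`, `v`, `t` of a `k`-algebra satisfying the defining relations of `kG`. -/
structure SuperTriple (k : Type) [Field k] (p : ℕ) (A : Type) [Ring A] [Algebra k A] where
  /-- the first odd generator -/
  u : A
  /-- the second odd generator -/
  v : A
  /-- the even generator -/
  t : A
  u_mul_u : u * u = 0
  v_mul_v : v * v = 0
  u_mul_v : u * v = -(v * u)
  t_pow : t ^ p = 0
  t_mul_v : t * v = v * t
  t_mul_u : t * u = u * t + v

namespace SuperTriple

open Polynomial

variable {k : Type} [Field k] {p : ℕ} {A : Type} [Ring A] [Algebra k A]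

/-- A triple of generators is universal if every other triple is the image of it under an algebra
homomorphism. -/
structure IsUniversal (g : SuperTriple k p A) : Prop where
  adjoin_eq_top : Algebra.adjoin k {g.u, g.v, g.t} = ⊤
  exists_lift : ∀ (B : Type) [Ring B] [Algebra k B] (h : SuperTriple k p B),
    ∃ f : A →ₐ[k] B, f g.u = h.u ∧ f g.v = h.v ∧ f g.t = h.t

variable (g : SuperTriple k p A)

lemma v_mul_u : g.v * g.u = -(g.u * g.v) := by
  rw [u_mul_v, neg_neg]

lemma u_mul_t : g.u * g.t = g.t * g.u - g.v := by
  rw [t_mul_u, add_sub_cancel_right]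

lemma v_mul_t_pow (n : ℕ) : g.v * g.t ^ n = g.t ^ n * g.v :=
  Commute.pow_right (show Commute g.v g.t from g.t_mul_v.symm) n

lemma u_mul_t_pow (n : ℕ) :
    g.u * g.t ^ n = g.t ^ n * g.u - (n : A) * (g.t ^ (n - 1) * g.v) := by
  induction n with
  | zero => simp
  | succ n ih =>
    rw [pow_succ, ← mul_assoc, ih, sub_mul, mul_assoc, u_mul_t, mul_assoc, mul_assoc,
      ← t_mul_v, mul_sub]
    rcases n with _ | n
    · simp
    · rw [Nat.add_sub_cancel, Nat.add_sub_cancel, ← mul_assoc _ g.t g.v, ← pow_succ]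
      push_cast
      noncomm_ring

lemma v_mul_aeval (f : k[X]) : g.v * aeval g.t f = aeval g.t f * g.v := by
  induction f using Polynomial.induction_on' with
  | add f g hf hg => rw [map_add, mul_add, add_mul, hf, hg]
  | monomial n a =>
    rw [← smul_X_eq_monomial, map_smul, aeval_X_pow, mul_smul_comm, smul_mul_assoc, v_mul_t_pow]

lemma u_mul_aeval (f : k[X]) : g.u * aeval g.t f =
    aeval g.t f * g.u - aeval g.t (derivative f) * g.v := by
  induction f using Polynomial.induction_on' with
  | add f g hf hg => simp only [map_add, mul_add, add_mul, hf, hg]; abel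
  | monomial n a =>
    rw [← smul_X_eq_monomial, derivative_smul, derivative_X_pow, map_smul, map_smul, map_mul,
      aeval_X_pow, aeval_X_pow, mul_smul_comm, smul_mul_assoc, smul_mul_assoc, u_mul_t_pow,
      smul_sub, C_eq_natCast, map_natCast, mul_assoc]

lemma t_mul_aeval (f : k[X]) : g.t * aeval g.t f = aeval g.t (X * f) := by
  rw [map_mul, aeval_X]

/-- The element `f₀(t) + f₁(t) u + f₂(t) v + f₃(t) u v`. -/
noncomputable def normalForm (f : Fin 4 → k[X]) : A :=
  aeval g.t (f 0) + aeval g.t (f 1) * g.u + aeval g.t (f 2) * g.v +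
    aeval g.t (f 3) * (g.u * g.v)

lemma v_mul_u_mul_v : g.v * (g.u * g.v) = 0 := by
  rw [← mul_assoc, v_mul_u, neg_mul, mul_assoc, v_mul_v, mul_zero, neg_zero]

lemma u_mul_u_mul (x : A) : g.u * (g.u * x) = 0 := by
  rw [← mul_assoc, u_mul_u, zero_mul]

lemma u_mul_normalForm (f : Fin 4 → k[X]) : g.u * g.normalForm f =
    g.normalForm ![0, f 0, -derivative (f 0), f 2 + derivative (f 1)] := by
  simp only [normalForm, mul_add, ← mul_assoc g.u (aeval _ _), u_mul_aeval, sub_mul]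
  simp only [mul_assoc, u_mul_u, v_mul_v, v_mul_u, v_mul_u_mul_v, u_mul_u_mul]
  simp [add_mul]
  abel

lemma v_mul_normalForm (f : Fin 4 → k[X]) : g.v * g.normalForm f =
    g.normalForm ![0, 0, f 0, -f 1] := by
  simp only [normalForm, mul_add, ← mul_assoc g.v (aeval _ _), v_mul_aeval]
  simp [mul_assoc, v_mul_v, v_mul_u, v_mul_u_mul_v]

lemma t_mul_normalForm (f : Fin 4 → k[X]) : g.t * g.normalForm f =
    g.normalForm (fun i => X * f i) := by
  simp only [normalForm, mul_add, ← mul_assoc, t_mul_aeval]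

lemma normalForm_mul_u (f : Fin 4 → k[X]) : g.normalForm f * g.u =
    g.normalForm ![0, f 0, 0, -f 2] := by
  simp [normalForm, add_mul, mul_assoc, u_mul_u, v_mul_u, u_mul_u_mul]

lemma normalForm_mul_v (f : Fin 4 → k[X]) : g.normalForm f * g.v =
    g.normalForm ![0, 0, f 0, f 1] := by
  simp [normalForm, add_mul, mul_assoc, v_mul_v]

lemma normalForm_add (f h : Fin 4 → k[X]) :
    g.normalForm (f + h) = g.normalForm f + g.normalForm h := by
  simp only [normalForm, Pi.add_apply, map_add, add_mul]
  abel

lemma normalForm_sub (f h : Fin 4 → k[X]) :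
    g.normalForm (f - h) = g.normalForm f - g.normalForm h := by
  simp only [normalForm, Pi.sub_apply, map_sub, sub_mul]
  abel

lemma aeval_eq_zero_of_dvd {f : k[X]} (h : X ^ p ∣ f) : aeval g.t f = 0 := by
  obtain ⟨q, rfl⟩ := h
  rw [map_mul, aeval_X_pow, t_pow, zero_mul]

section Truncated

variable (k p)

/-- The truncated polynomials `k[X]/(X ^ p)`, as a `k`-module. -/
abbrev Trunc : Type := k[X] ⧸ (Ideal.span {(X : k[X]) ^ p}).restrictScalars k

/-- Multiplication by `X` on truncated polynomials. -/
noncomputable def truncX : Module.End k (Trunc k p) :=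
  Submodule.mapQ _ _ (LinearMap.mulLeft k X) fun _ hf => Ideal.mul_mem_left _ _ hf

/-- The derivative on truncated polynomials. -/
noncomputable def truncDeriv [CharP k p] : Module.End k (Trunc k p) :=
  Submodule.mapQ _ _ derivative fun f hf => by
    simp only [Submodule.restrictScalars_mem, Submodule.mem_comap, Ideal.mem_span_singleton] at hf ⊢
    obtain ⟨g, rfl⟩ := hf
    simp [derivative_X_pow]

lemma truncX_pow_mk (n : ℕ) (f : k[X]) :
    (truncX k p ^ n) (Submodule.Quotient.mk f) = Submodule.Quotient.mk (X ^ n * f) := by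
  induction n with
  | zero => simp
  | succ n ih =>
    rw [pow_succ', Module.End.mul_apply, ih, pow_succ', mul_assoc]
    rfl

lemma trunc_mk_eq_zero {f : k[X]} :
    (Submodule.Quotient.mk f : Trunc k p) = 0 ↔ X ^ p ∣ f := by
  rw [Submodule.Quotient.mk_eq_zero, Submodule.restrictScalars_mem, Ideal.mem_span_singleton]

lemma truncX_pow_self : truncX k p ^ p = 0 := by
  refine LinearMap.ext fun f => ?_
  obtain ⟨f, rfl⟩ := Submodule.Quotient.mk_surjective _ f
  rw [truncX_pow_mk, LinearMap.zero_apply, trunc_mk_eq_zero]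
  exact dvd_mul_right _ _

lemma truncX_mul_truncDeriv [CharP k p] :
    truncX k p * truncDeriv k p = truncDeriv k p * truncX k p - 1 := by
  refine LinearMap.ext fun f => ?_
  obtain ⟨f, rfl⟩ := Submodule.Quotient.mk_surjective _ f
  refine congrArg (Submodule.Quotient.mk (p := (Ideal.span {(X : k[X]) ^ p}).restrictScalars k))
    (show X * derivative f = derivative (X * f) - f from ?_)
  rw [derivative_mul, derivative_X, one_mul, add_sub_cancel_left]

lemma aeval_truncX_mk (f h : k[X]) :
    aeval (truncX k p) f (Submodule.Quotient.mk h) = Submodule.Quotient.mk (f * h) := by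
  induction f using Polynomial.induction_on' with
  | add f g hf hg => rw [map_add, LinearMap.add_apply, hf, hg, add_mul, Submodule.Quotient.mk_add]
  | monomial n a =>
    rw [← smul_X_eq_monomial, map_smul, aeval_X_pow, LinearMap.smul_apply, truncX_pow_mk,
      smul_mul_assoc, Submodule.Quotient.mk_smul]

end Truncated

/-- The matrices of the left regular representation of `kG` over an algebra in which the
Weyl relation holds. -/
def ofWeyl {R : Type} [Ring R] [Algebra k R] (x d : R) (hx : x ^ p = 0)
    (hxd : x * d = d * x - 1) : SuperTriple k p (Matrix (Fin 4) (Fin 4) R) where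
  u := !![0, 0, 0, 0; 1, 0, 0, 0; -d, 0, 0, 0; 0, d, 1, 0]
  v := !![0, 0, 0, 0; 0, 0, 0, 0; 1, 0, 0, 0; 0, -1, 0, 0]
  t := Matrix.scalar (Fin 4) x
  u_mul_u := by simp [← Matrix.ext_iff, Fin.forall_fin_succ]
  v_mul_v := by simp [← Matrix.ext_iff, Fin.forall_fin_succ]
  u_mul_v := by simp
  t_pow := by rw [← map_pow, hx, map_zero]
  t_mul_v := by
    simp [← Matrix.ext_iff, Fin.forall_fin_succ, Matrix.mul_apply, Fin.sum_univ_four]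
  t_mul_u := by
    simp [← Matrix.ext_iff, Fin.forall_fin_succ, Matrix.mul_apply, Fin.sum_univ_four, hxd]
    constructor <;> abel

lemma ofWeyl_normalForm {R : Type} [Ring R] [Algebra k R] (x d : R) (hx : x ^ p = 0)
    (hxd : x * d = d * x - 1) (f : Fin 4 → k[X]) :
    (fun i => (ofWeyl (k := k) x d hx hxd).normalForm f i 0) =
      ![aeval x (f 0), aeval x (f 1), aeval x (f 2) - aeval x (f 1) * d, aeval x (f 3)] := by
  have h (q : k[X]) : aeval (ofWeyl (k := k) x d hx hxd).t q =
      Matrix.scalar (Fin 4) (aeval x q) := by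
    induction q using Polynomial.induction_on' with
    | add q r hq hr => rw [map_add, map_add, map_add, hq, hr]
    | monomial n a =>
      rw [aeval_monomial, aeval_monomial, map_mul]
      simp [ofWeyl, Matrix.algebraMap_eq_diagonal, Pi.algebraMap_def, Matrix.diagonal_pow]
  have huv : (ofWeyl (k := k) x d hx hxd).u * (ofWeyl (k := k) x d hx hxd).v =
      !![0, 0, 0, 0; 0, 0, 0, 0; 0, 0, 0, 0; 1, 0, 0, 0] := by
    simp only [ofWeyl, Matrix.cons_mul]
    simp
    ext i
    fin_cases i <;> rfl
  funext i
  simp only [normalForm, h, huv, Matrix.add_apply, Matrix.scalar_apply, Matrix.diagonal_mul]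
  fin_cases i <;> simp [ofWeyl, neg_add_eq_sub]

namespace IsUniversal

variable {g} (hg : g.IsUniversal)
include hg

lemma exists_normalForm (a : A) : ∃ f, g.normalForm f = a := by
  let S : Submodule k A :=
    { carrier := Set.range g.normalForm
      zero_mem' := ⟨0, by simp [normalForm]⟩
      add_mem' := by
        rintro _ _ ⟨f, rfl⟩ ⟨h, rfl⟩
        exact ⟨f + h, g.normalForm_add f h⟩
      smul_mem' := by
        rintro c _ ⟨f, rfl⟩
        exact ⟨c • f, by simp [normalForm]⟩ }
  have key : ∀ a ∈ Algebra.adjoin k {g.u, g.v, g.t}, ∀ x ∈ S, a * x ∈ S := by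
    intro a ha
    induction ha using Algebra.adjoin_induction with
    | mem a ha =>
      rintro _ ⟨f, rfl⟩
      rcases ha with rfl | rfl | rfl
      exacts [⟨_, (g.u_mul_normalForm f).symm⟩, ⟨_, (g.v_mul_normalForm f).symm⟩,
        ⟨_, (g.t_mul_normalForm f).symm⟩]
    | algebraMap r =>
      intro x hx
      rw [← Algebra.smul_def]
      exact S.smul_mem r hx
    | add a b _ _ ha hb =>
      intro x hx
      rw [add_mul]
      exact S.add_mem (ha x hx) (hb x hx)
    | mul a b _ _ ha hb =>
      intro x hx
      rw [mul_assoc]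
      exact ha _ (hb x hx)
  have := key a (hg.adjoin_eq_top ▸ Algebra.mem_top) 1 ⟨![1, 0, 0, 0], by simp [normalForm]⟩
  rwa [mul_one] at this

lemma dvd_of_normalForm_eq_zero [CharP k p] {f : Fin 4 → k[X]} (hf : g.normalForm f = 0)
    (i : Fin 4) : X ^ p ∣ f i := by
  let r := ofWeyl (k := k) _ _ (truncX_pow_self k p) (truncX_mul_truncDeriv k p)
  obtain ⟨φ, hu, hv, ht⟩ := hg.exists_lift _ r
  have h : r.normalForm f = 0 := by
    rw [← map_zero φ, ← hf]
    simp only [normalForm, map_add, map_mul, ← aeval_algHom_apply, hu, hv, ht]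
  have h2 := ofWeyl_normalForm (k := k) _ _ (truncX_pow_self k p) (truncX_mul_truncDeriv k p) f
  change (fun i => r.normalForm f i 0) = _ at h2
  rw [h] at h2
  have h3 (j : Fin 4) := congrArg (fun T : Module.End k (Trunc k p) =>
    T (Submodule.Quotient.mk 1)) (congrFun h2 j)
  have hd : truncDeriv k p (Submodule.Quotient.mk 1) = 0 := by
    change Submodule.Quotient.mk (derivative 1) = _
    rw [derivative_one, Submodule.Quotient.mk_zero]
  rw [← trunc_mk_eq_zero k p]
  have h4 := h3 i
  fin_cases i <;> simpa [aeval_truncX_mk, hd] using h4.symm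

/-- Multiplication by `v` is exact. -/
lemma exists_mul_v_of_mul_v_eq_zero [CharP k p] {z : A} (hz : z * g.v = 0) :
    ∃ y, y * g.v = z := by
  obtain ⟨f, rfl⟩ := hg.exists_normalForm z
  rw [normalForm_mul_v] at hz
  have h0 := g.aeval_eq_zero_of_dvd (hg.dvd_of_normalForm_eq_zero hz 2)
  have h1 := g.aeval_eq_zero_of_dvd (hg.dvd_of_normalForm_eq_zero hz 3)
  refine ⟨g.normalForm ![f 2, f 3, 0, 0], ?_⟩
  rw [normalForm_mul_v]
  simp at h0 h1
  simp [normalForm, h0, h1]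

/-- Multiplication by `u` is exact modulo left multiples of `v`. -/
lemma exists_mul_u_of_mul_u_eq [CharP k p] {z y : A} (hz : z * g.u = y * g.v) :
    ∃ a b, z - a * g.u = b * g.v := by
  obtain ⟨f, rfl⟩ := hg.exists_normalForm z
  obtain ⟨h, rfl⟩ := hg.exists_normalForm y
  rw [normalForm_mul_v, normalForm_mul_u, ← sub_eq_zero, ← normalForm_sub] at hz
  have h0 := g.aeval_eq_zero_of_dvd (hg.dvd_of_normalForm_eq_zero hz 1)
  refine ⟨g.normalForm ![f 1, 0, 0, 0], g.normalForm ![f 2, f 3, 0, 0], ?_⟩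
  rw [normalForm_mul_v, normalForm_mul_u]
  change aeval g.t (f 0 - 0) = 0 at h0
  rw [sub_zero] at h0
  simp [normalForm, h0]
  abel

/-- The quotient of `kG` by the ideal generated by `u` and `v`. -/
lemma exists_quotient :
    ∃ φ : A →ₐ[k] k[X] ⧸ Ideal.span {(X : k[X]) ^ p}, φ g.u = 0 ∧ φ g.v = 0 ∧
      φ g.t = Ideal.Quotient.mk _ X := by
  refine hg.exists_lift _ ⟨0, 0, Ideal.Quotient.mk _ X, ?_, ?_, ?_, ?_, ?_, ?_⟩
  on_goal 4 =>
    rw [← map_pow, Ideal.Quotient.eq_zero_iff_mem]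
    exact Ideal.mem_span_singleton_self _
  all_goals simp

section Quotient

variable {φ : A →ₐ[k] k[X] ⧸ Ideal.span {(X : k[X]) ^ p}} (hu : φ g.u = 0) (hv : φ g.v = 0)
  (ht : φ g.t = Ideal.Quotient.mk _ X)
include hu hv ht

omit hg hu hv in
lemma quotient_aeval (f : k[X]) : φ (aeval g.t f) = Ideal.Quotient.mk _ f := by
  rw [← aeval_algHom_apply, ht]
  have := aeval_algHom_apply (Ideal.Quotient.mkₐ k (Ideal.span {(X : k[X]) ^ p})) X f
  rwa [aeval_X_left_apply] at this

omit hg in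
lemma quotient_normalForm (f : Fin 4 → k[X]) :
    φ (g.normalForm f) = Ideal.Quotient.mk _ (f 0) := by
  simp [normalForm, hu, hv, quotient_aeval ht]

/-- The kernel of `kG → k[t]/(t ^ p)` is the left ideal generated by `u` and `v`. -/
lemma exists_of_quotient_eq_zero {z : A} (hz : φ z = 0) : ∃ a b, z - a * g.u = b * g.v := by
  obtain ⟨f, rfl⟩ := hg.exists_normalForm z
  rw [quotient_normalForm hu hv ht, Ideal.Quotient.eq_zero_iff_mem, Ideal.mem_span_singleton] at hz
  refine ⟨g.normalForm ![f 1, 0, 0, 0], g.normalForm ![f 2, f 3, 0, 0], ?_⟩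
  rw [normalForm_mul_v, normalForm_mul_u]
  simp [normalForm, g.aeval_eq_zero_of_dvd hz]
  abel

/-- Exactness of the periodic resolution over `k[t]/(t ^ p)`. -/
lemma exists_of_quotient_mul_pow_eq_zero {z : A} {m n : ℕ} (hmn : m + n = p)
    (hz : φ (z * g.t ^ m) = 0) : ∃ y, φ (z - y * g.t ^ n) = 0 := by
  obtain ⟨f, rfl⟩ := hg.exists_normalForm z
  rw [map_mul, map_pow, quotient_normalForm hu hv ht, ht, ← map_pow, ← map_mul,
    Ideal.Quotient.eq_zero_iff_mem, Ideal.mem_span_singleton, ← hmn, pow_add, mul_comm] at hz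
  obtain ⟨q, hq⟩ := (mul_dvd_mul_iff_right (pow_ne_zero m (X_ne_zero (R := k)))).1 hz
  refine ⟨aeval g.t q, ?_⟩
  rw [map_sub, map_mul, map_pow, quotient_normalForm hu hv ht, quotient_aeval ht, ht,
    ← map_pow, ← map_mul, hq, mul_comm, sub_self]

/-- The augmentation ideal is generated by `t` modulo `u` and `v`. -/
lemma exists_of_augmentation_eq_zero {ε : A →ₐ[k] k} (hεu : ε g.u = 0) (hεv : ε g.v = 0)
    (hεt : ε g.t = 0) {z : A} (hz : ε z = 0) : ∃ y, φ (z - y * g.t) = 0 := by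
  obtain ⟨f, rfl⟩ := hg.exists_normalForm z
  have h : ε (g.normalForm f) = (f 0).coeff 0 := by
    rw [normalForm, map_add, map_add, map_add, map_mul, map_mul, map_mul, map_mul, hεu, hεv,
      ← aeval_algHom_apply, hεt, coeff_zero_eq_aeval_zero]
    simp
  obtain ⟨q, hq⟩ := X_dvd_iff.2 (h.symm.trans hz)
  refine ⟨aeval g.t q, ?_⟩
  rw [map_sub, map_mul, quotient_normalForm hu hv ht, quotient_aeval ht, ht,
    ← map_mul, hq, mul_comm, sub_self]

end Quotient
end IsUniversal
end SuperTriple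

namespace Totalization

variable {A : Type} [Ring A] {N : Type} [AddCommGroup N] [Module A N]

/-- The differential of the total complex of a double complex whose rows are copies of `N` with
differentials `d i`, and whose `i`-th row is mapped to the previous one by `δ i`. -/
noncomputable def total (d δ : ℕ → N →ₗ[A] N) : (ℕ →₀ N) →ₗ[A] (ℕ →₀ N) :=
  Finsupp.lsum ℕ fun i => Finsupp.lsingle i ∘ₗ d i + Finsupp.lsingle (i - 1) ∘ₗ δ i

variable {d δ : ℕ → N →ₗ[A] N}

@[simp]
lemma total_single (i : ℕ) (z : N) :
    total d δ (Finsupp.single i z) = Finsupp.single i (d i z) + Finsupp.single (i - 1) (δ i z) := by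
  simp [total]

lemma total_apply (hδ : δ 0 = 0) (z : ℕ →₀ N) (i : ℕ) :
    total d δ z i = d i (z i) + δ (i + 1) (z (i + 1)) := by
  induction z using Finsupp.induction_linear with
  | zero => simp
  | add z w hz hw =>
    simp only [map_add, Finsupp.add_apply, hz, hw]
    abel
  | single j z =>
    rw [total_single, Finsupp.add_apply]
    congr 1
    · by_cases h : j = i
      · subst h; simp
      · simp [h]
    · rcases j with _ | j
      · simp [hδ]
      · by_cases h : j = i
        · subst h; simp
        · simp [h]

lemma total_comp_total (hδ : δ 0 = 0) (hdd : ∀ i z, d i (d i z) = 0)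
    (hdδ : ∀ i z, d i (δ (i + 1) z) + δ (i + 1) (d (i + 1) z) = 0)
    (hδδ : ∀ i z, δ (i + 1) (δ (i + 2) z) = 0) (z : ℕ →₀ N) :
    total d δ (total d δ z) = 0 := by
  ext i
  simp [total_apply hδ, hdd, hδδ, hdδ]

/-- The total complex is exact if the rows have homology only in one place, detected by `B`, and
the column formed by these homology modules is exact, except at its end, where the homology is
detected by `B'`. -/
lemma exists_total_eq (hδ : δ 0 = 0) (hdd : ∀ i z, d i (d i z) = 0)
    (hdδ : ∀ i z, d i (δ (i + 1) z) + δ (i + 1) (d (i + 1) z) = 0)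
    (hδδ : ∀ i z, δ (i + 1) (δ (i + 2) z) = 0)
    (B B' : Submodule A N) (hdB : ∀ i z, d i z ∈ B)
    (hB : ∀ i, ∀ z ∈ B, d i z = 0 → ∃ y, d i y = z)
    (h₀ : ∀ z ∈ B', d 0 z = 0 → ∃ y, d 1 y = 0 ∧ z - δ 1 y ∈ B)
    (h : ∀ i z, d (i + 1) z = 0 → δ (i + 1) z ∈ B → ∃ y, d (i + 2) y = 0 ∧ z - δ (i + 2) y ∈ B)
    (hdB' : ∀ z, d 0 z ∈ B') (hδB' : ∀ z, δ 1 z ∈ B')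
    (z : ℕ →₀ N) (hz : total d δ z = 0) (hz₀ : z 0 ∈ B') :
    ∃ y, total d δ y = z := by
  obtain ⟨n, hn⟩ : ∃ n, ∀ i, n ≤ i → z i = 0 := by
    obtain ⟨n, hn⟩ := z.support.bddAbove
    refine ⟨n + 1, fun i hi => ?_⟩
    by_contra hne
    have := hn (Finsupp.mem_support_iff.2 hne)
    omega
  induction n generalizing z with
  | zero => exact ⟨0, by ext i; simp [hn]⟩
  | succ n ih =>
    have hdn : d n (z n) = 0 := by
      have := DFunLike.congr_fun hz n
      rw [total_apply hδ, hn (n + 1) le_rfl] at this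
      simpa using this
    obtain ⟨y, hy, hyB⟩ : ∃ y, d (n + 1) y = 0 ∧ z n - δ (n + 1) y ∈ B := by
      rcases n with _ | n
      · exact h₀ _ hz₀ hdn
      · refine h n _ hdn ?_
        have := DFunLike.congr_fun hz n
        rw [total_apply hδ, Finsupp.zero_apply] at this
        rw [eq_neg_of_add_eq_zero_right this]
        exact neg_mem (hdB _ _)
    have hc : d n (δ (n + 1) y) = 0 := by simpa [hy] using hdδ n y
    obtain ⟨w, hw⟩ := hB n _ hyB (by rw [map_sub, hdn, hc, sub_zero])
    have hddw : total d δ (Finsupp.single (n + 1) y + Finsupp.single n w) =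
        Finsupp.single n (z n) + Finsupp.single (n - 1) (δ n w) := by
      rw [map_add, total_single, total_single, hy, hw, Finsupp.single_zero, zero_add,
        Nat.add_sub_cancel, ← add_assoc, ← Finsupp.single_add, add_sub_cancel]
    obtain ⟨x, hx⟩ := ih (z - total d δ (Finsupp.single (n + 1) y + Finsupp.single n w))
      (by rw [map_sub, hz, total_comp_total hδ hdd hdδ hδδ, sub_zero])
      (by
        rw [Finsupp.sub_apply, total_apply hδ]
        exact sub_mem hz₀ (add_mem (hdB' _) (hδB' _)))
      (fun i hi => by
        rw [hddw, Finsupp.sub_apply, Finsupp.add_apply]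
        rcases hi.eq_or_lt with rfl | hi
        · rcases n with _ | n
          · simp [hδ]
          · simp
        · rw [hn i hi, Finsupp.single_eq_of_ne (by omega), Finsupp.single_eq_of_ne (by omega)]
          simp)
    exact ⟨x + (Finsupp.single (n + 1) y + Finsupp.single n w), by rw [map_add, hx, sub_add_cancel]⟩

end Totalization

/-- Finitely supported double sequences. -/
def Grid (A : Type) [Ring A] : Type := ℕ →₀ ℕ →₀ A

namespace Grid

variable {A : Type} [Ring A]

noncomputable instance : AddCommGroup (Grid A) := inferInstanceAs (AddCommGroup (ℕ →₀ ℕ →₀ A))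

noncomputable instance : Module A (Grid A) := inferInstanceAs (Module A (ℕ →₀ ℕ →₀ A))

instance : FunLike (Grid A) ℕ (ℕ →₀ A) := inferInstanceAs (FunLike (ℕ →₀ ℕ →₀ A) ℕ (ℕ →₀ A))

@[ext]
lemma ext {z w : Grid A} (h : ∀ a b, z a b = w a b) : z = w :=
  Finsupp.ext fun a => Finsupp.ext (h a)

@[simp]
lemma zero_apply (a : ℕ) : (0 : Grid A) a = 0 := rfl

@[simp]
lemma add_apply (z w : Grid A) (a : ℕ) : (z + w) a = z a + w a := rfl

@[simp]
lemma neg_apply (z : Grid A) (a : ℕ) : (-z) a = -z a := rfl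

@[simp]
lemma sub_apply (z w : Grid A) (a : ℕ) : (z - w) a = z a - w a := rfl

@[simp]
lemma smul_apply (r : A) (z : Grid A) (a : ℕ) : (r • z) a = r • z a := rfl

@[simp]
lemma nsmul_apply (n : ℕ) (z : Grid A) (a : ℕ) : (n • z) a = n • z a := rfl

/-- The double sequence with one nonzero entry. -/
noncomputable def single (a b : ℕ) : A →ₗ[A] Grid A :=
  Finsupp.lsingle (M := ℕ →₀ A) a ∘ₗ Finsupp.lsingle b

lemma single_apply (a b a' b' : ℕ) (r : A) :
    single a b r a' b' = if a = a' ∧ b = b' then r else 0 := by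
  change Finsupp.single a (Finsupp.single b r) a' b' = _
  by_cases h : a = a'
  · simp [h, Finsupp.single_apply]
  · simp [h]

lemma induction_linear {motive : Grid A → Prop} (z : Grid A) (zero : motive 0)
    (add : ∀ z w, motive z → motive w → motive (z + w)) (single : ∀ a b r, motive (single a b r)) :
    motive z := by
  refine Finsupp.induction_linear z zero add fun a z => ?_
  induction z using Finsupp.induction_linear with
  | zero => rwa [Finsupp.single_zero]
  | add z w hz hw => rw [Finsupp.single_add]; exact add _ _ hz hw
  | single b r => exact single a b r

end Grid

namespace SuperTriple

section Differentials

variable {k : Type} [Field k] {p : ℕ} {A : Type} [Ring A] [Algebra k A] (g : SuperTriple k p A)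

open Finsupp hiding add_apply sub_apply
open Totalization

/-- The action of right multiplication by `x` on double sequences. -/
noncomputable def rightMul (x : A) : Module.End A (Grid A) :=
  mapRange.linearMap (mapRange.linearMap (LinearMap.toSpanSingleton A A x))

@[simp]
lemma rightMul_apply (x : A) (z : Grid A) (a b : ℕ) : rightMul x z a b = z a b * x := rfl

/-- The complex of right multiplications by `v`. -/
noncomputable def dv : (ℕ →₀ A) →ₗ[A] (ℕ →₀ A) :=
  total (fun _ => 0) fun i => if i = 0 then 0 else LinearMap.toSpanSingleton A A g.v

lemma dv_apply (z : ℕ →₀ A) (b : ℕ) : g.dv z b = z (b + 1) * g.v := by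
  simp [dv, total_apply]

/-- The Koszul type resolution of `A ⧸ (A u + A v)`. -/
noncomputable def duv : Module.End A (Grid A) :=
  total (fun _ => g.dv) fun i => if i = 0 then 0 else
    mapRange.linearMap (LinearMap.toSpanSingleton A A g.u)

lemma duv_apply (z : Grid A) (a b : ℕ) :
    g.duv z a b = z a (b + 1) * g.v + z (a + 1) b * g.u := by
  refine (DFunLike.congr_fun (total_apply (N := ℕ →₀ A) (if_pos rfl) z a) b).trans ?_
  rw [Finsupp.add_apply, dv_apply]
  rfl

lemma dv_dv (z : ℕ →₀ A) : g.dv (g.dv z) = 0 := by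
  ext b
  simp [dv_apply, mul_assoc, g.v_mul_v]

lemma duv_duv (z : Grid A) : g.duv (g.duv z) = 0 := by
  ext a b
  simp [duv_apply, add_mul, mul_assoc, g.v_mul_v, g.u_mul_u, g.u_mul_v]

/-- The operator `r e_{a,b} ↦ -(b + 1) r e_{a-1,b+1}`. -/
noncomputable def shift (A : Type) [Ring A] : Module.End A (Grid A) :=
  lsum ℕ fun a => if a = 0 then 0 else
    lsum ℕ fun b => Grid.single (a - 1) (b + 1) ∘ₗ LinearMap.toSpanSingleton A A (-(b + 1))

lemma shift_single (a b : ℕ) (r : A) : shift A (Grid.single a b r) =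
    if a = 0 then 0 else Grid.single (a - 1) (b + 1) (r * -(b + 1)) := by
  refine (lsum_single ℕ _ a _).trans ?_
  split_ifs with h
  · rfl
  · exact lsum_single ℕ _ b r

lemma shift_pow_single (n a b : ℕ) (r : A) : (shift A ^ n) (Grid.single a b r) =
    if a < n then 0 else
      Grid.single (a - n) (b + n) (r * ((-1) ^ n * ((b + 1).ascFactorial n : ℕ))) := by
  induction n with
  | zero => simp
  | succ n ih =>
    rw [pow_succ', Module.End.mul_apply, ih]
    split_ifs with h h' h'
    · simp
    · omega
    · rw [shift_single, if_pos (by omega)]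
    · rw [shift_single, if_neg (by omega), Nat.sub_sub, add_assoc, mul_assoc, mul_assoc,
        Nat.ascFactorial_succ, pow_succ, mul_assoc, Nat.cast_mul, Nat.cast_comm]
      congr 3
      push_cast
      rw [neg_one_mul, add_right_comm, neg_mul]

lemma shift_apply_zero (z : Grid A) (a : ℕ) : shift A z a 0 = 0 := by
  induction z using Grid.induction_linear with
  | zero => simp
  | add z w hz hw => simp [hz, hw]
  | single a' b' r =>
    rw [shift_single]
    split_ifs <;> simp [Grid.single_apply]

lemma shift_apply_succ (z : Grid A) (a b : ℕ) :
    shift A z a (b + 1) = -((b + 1) • z (a + 1) b) := by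
  induction z using Grid.induction_linear with
  | zero => simp
  | add z w hz hw => simp [hz, hw, add_comm]
  | single a' b' r =>
    rw [shift_single]
    rcases a' with _ | a'
    · simp [Grid.single_apply]
    · by_cases h : a' = a ∧ b' = b
      · simp [Grid.single_apply, h, mul_add, add_mul, Nat.cast_comm]
      · simp [Grid.single_apply, h]

lemma shift_commute (x : A) : Commute (rightMul x) (shift A) := by
  refine LinearMap.ext fun z => ?_
  ext a b
  rcases b with _ | b
  · simp [shift_apply_zero]
  · simp [shift_apply_succ, mul_assoc]

/-- The operator on the Koszul type resolution of `A ⧸ (A u + A v)` lifting right multiplication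
by `t`. -/
noncomputable def dt : Module.End A (Grid A) := rightMul g.t + shift A

lemma dt_apply_zero (z : Grid A) (a : ℕ) : g.dt z a 0 = z a 0 * g.t := by
  simp [dt, shift_apply_zero]

lemma dt_apply_succ (z : Grid A) (a b : ℕ) :
    g.dt z a (b + 1) = z a (b + 1) * g.t - (b + 1) • z (a + 1) b := by
  simp [dt, shift_apply_succ, sub_eq_add_neg]

lemma dt_pow_apply (n : ℕ) (z : Grid A) (a : ℕ) : (g.dt ^ n) z a 0 = z a 0 * g.t ^ n := by
  induction n generalizing z with
  | zero => simp
  | succ n ih => rw [pow_succ', Module.End.mul_apply, dt_apply_zero, ih, pow_succ, mul_assoc]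

lemma duv_dt : Commute g.duv g.dt := by
  refine LinearMap.ext fun z => ?_
  ext a b
  rcases b with _ | b
  · simp [duv_apply, dt_apply_zero, dt_apply_succ, add_mul, sub_mul, mul_assoc, g.t_mul_u,
      g.t_mul_v, mul_add]
  · simp [duv_apply, dt_apply_succ, add_mul, sub_mul, mul_assoc, g.t_mul_u, g.t_mul_v, mul_add]
    abel

lemma rightMul_pow (x : A) (n : ℕ) : rightMul x ^ n = rightMul (x ^ n) := by
  induction n with
  | zero => ext; simp
  | succ n ih =>
    refine LinearMap.ext fun z => ?_
    ext a b
    rw [pow_succ', ih]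
    simp [pow_succ, mul_assoc]

lemma dt_pow [CharP k p] [hp : Fact p.Prime] : g.dt ^ p = 0 := by
  have hA : (p : A) = 0 := by rw [← map_natCast (algebraMap k A), CharP.cast_eq_zero, map_zero]
  obtain ⟨r, hr⟩ := (shift_commute g.t).exists_add_pow_prime_eq hp.out
  have h₁ : rightMul g.t ^ p = 0 := by
    rw [rightMul_pow, g.t_pow]
    refine LinearMap.ext fun z => ?_
    ext a b
    simp
  have h₂ : shift A ^ p = 0 := by
    refine LinearMap.ext fun z => ?_
    induction z using Grid.induction_linear with
    | zero => simp
    | add z w hz hw => simp [hz, hw]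
    | single a b r =>
      obtain ⟨c, hc⟩ := (hp.out.dvd_factorial.2 le_rfl).trans
        (Nat.factorial_dvd_ascFactorial (b + 1) p)
      simp [shift_pow_single, hc, hA]
  have h₃ : ((p : ℕ) : Module.End A (Grid A)) = 0 := by
    refine LinearMap.ext fun z => ?_
    ext a b
    simp [hA]
  rw [dt, hr, h₁, h₂, h₃, zero_mul, zero_mul, zero_mul, add_zero, add_zero]

/-- The exponents of `t` in the periodic resolution over `k[t]/(t ^ p)`. -/
def exponent (p i : ℕ) : ℕ := if Odd i then 1 else p - 1

/-- The differential of the resolution of the trivial module. -/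
noncomputable def duvt : (ℕ →₀ Grid A) →ₗ[A] (ℕ →₀ Grid A) :=
  total (fun i => (-1 : ℤ) ^ i • g.duv) fun i => if i = 0 then 0 else g.dt ^ exponent p i

lemma exponent_add [hp : Fact p.Prime] (i : ℕ) : exponent p i + exponent p (i + 1) = p := by
  have := hp.out.two_le
  by_cases h : Odd i
  · rw [exponent, exponent, if_pos h, if_neg (by simpa [Nat.odd_add_one] using h)]
    omega
  · rw [exponent, exponent, if_neg h, if_pos (by simpa [Nat.odd_add_one] using h)]
    omega

lemma dt_pow_dt_pow [CharP k p] [Fact p.Prime] (i : ℕ) (z : Grid A) :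
    (g.dt ^ exponent p i) ((g.dt ^ exponent p (i + 1)) z) = 0 := by
  rw [← Module.End.mul_apply, ← pow_add, exponent_add, dt_pow, LinearMap.zero_apply]

lemma neg_one_pow_smul_duv_eq_zero_iff (i : ℕ) (z : Grid A) :
    ((-1 : ℤ) ^ i • g.duv) z = 0 ↔ g.duv z = 0 := by
  rcases neg_one_pow_eq_or ℤ i with h | h <;> simp [h]

lemma neg_one_pow_smul_duv_smul_duv (i : ℕ) (z : Grid A) :
    ((-1 : ℤ) ^ i • g.duv) (((-1 : ℤ) ^ i • g.duv) z) = 0 := by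
  rcases neg_one_pow_eq_or ℤ i with h | h <;> simp [h, duv_duv]

lemma smul_duv_dt_pow (i n : ℕ) (z : Grid A) : ((-1 : ℤ) ^ i • g.duv) ((g.dt ^ n) z) +
    (g.dt ^ n) (((-1 : ℤ) ^ (i + 1) • g.duv) z) = 0 := by
  have := LinearMap.congr_fun (g.duv_dt.pow_right n) z
  simp only [Module.End.mul_apply] at this
  rcases neg_one_pow_eq_or ℤ i with h | h <;> simp [h, pow_succ, this]

lemma duvt_duvt [CharP k p] [Fact p.Prime] (z : ℕ →₀ Grid A) : g.duvt (g.duvt z) = 0 := by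
  refine total_comp_total (if_pos rfl) g.neg_one_pow_smul_duv_smul_duv
    (fun i => ?_) (fun i => ?_) z
  · exact g.smul_duv_dt_pow i _
  · exact g.dt_pow_dt_pow (i + 1)

variable {g} in
lemma exists_dv_eq [CharP k p] (hg : g.IsUniversal) {z : ℕ →₀ A} (hz : g.dv z = 0)
    (hz₀ : ∃ y, y * g.v = z 0) : ∃ y, g.dv y = z := by
  refine exists_total_eq (by simp) (by simp) (by simp) ?_ ⊥
    (LinearMap.range (LinearMap.toSpanSingleton A A g.v)) (by simp) (by simp) ?_ ?_ (by simp)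
    (by simp) z hz (by simpa using hz₀)
  · simp [mul_assoc, g.v_mul_v]
  · simp [sub_eq_zero, eq_comm]
  · intro i z _ hz
    obtain ⟨y, rfl⟩ := hg.exists_mul_v_of_mul_v_eq_zero (z := z) (by simpa using hz)
    exact ⟨y, by simp⟩

variable {g} in
lemma exists_duv_eq [CharP k p] (hg : g.IsUniversal)
    {z : Grid A} (hz : g.duv z = 0) (hz₀ : ∃ a b, z 0 0 - a * g.u = b * g.v) :
    ∃ y, g.duv y = z := by
  obtain ⟨φ, hu, hv, ht⟩ := hg.exists_quotient
  have hd (a : A) : g.dv (single 0 a) = 0 := by simp [dv]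
  refine exists_total_eq (by simp) (by simp [dv_dv]) ?_ ?_
    ((LinearMap.range (LinearMap.toSpanSingleton A A g.v)).comap (lapply 0))
    { carrier := {z : ℕ →₀ A | φ (z 0) = 0}
      add_mem' := by simp +contextual
      zero_mem' := by simp
      smul_mem' := by simp +contextual } ?_ ?_ ?_ ?_ ?_ ?_ z hz ?_
  · intro i z
    ext b
    simp [dv_apply, mul_assoc, g.u_mul_v]
  · intro i z
    ext b
    simp [mul_assoc, g.u_mul_u]
  · intro i z
    simp [dv_apply]
  · intro _ z hz hdz
    exact exists_dv_eq hg hdz (by simpa using hz)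
  · intro z hz _
    obtain ⟨a, b, hab⟩ := hg.exists_of_quotient_eq_zero hu hv ht hz
    exact ⟨single 0 a, hd a, b, by simp [hab]⟩
  · intro i z _ hz
    obtain ⟨y, hy⟩ := hz
    obtain ⟨a, b, hab⟩ := hg.exists_mul_u_of_mul_u_eq (z := z 0) (y := y) (by simpa using hy.symm)
    exact ⟨single 0 a, hd a, b, by simp [hab]⟩
  · intro z
    simp [dv_apply, hv]
  · intro z
    simp [hu]
  · obtain ⟨a, b, hab⟩ := hz₀
    change φ (z 0 0) = 0
    simp [sub_eq_iff_eq_add.1 hab, hu, hv]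

variable {g} in
lemma exists_duvt_eq [CharP k p] [Fact p.Prime] (hg : g.IsUniversal)
    {ε : A →ₐ[k] k} (hεu : ε g.u = 0) (hεv : ε g.v = 0) (hεt : ε g.t = 0)
    {z : ℕ →₀ Grid A} (hz : g.duvt z = 0) (hz₀ : ε (z 0 0 0) = 0) : ∃ y, g.duvt y = z := by
  obtain ⟨φ, hu, hv, ht⟩ := hg.exists_quotient
  have hd (a : A) : g.duv (Grid.single 0 0 a) = 0 := by
    ext a' b'
    simp [duv_apply, Grid.single_apply]
  have hδ (i : ℕ) (a : A) : (g.dt ^ i) (Grid.single 0 0 a) 0 0 = a * g.t ^ i := by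
    simp [dt_pow_apply, Grid.single_apply]
  refine exists_total_eq (if_pos rfl) g.neg_one_pow_smul_duv_smul_duv
    (fun i => ?_) (fun i => ?_)
    { carrier := {z : Grid A | φ (z 0 0) = 0}
      add_mem' := by simp +contextual
      zero_mem' := by simp
      smul_mem' := by simp +contextual }
    { carrier := {z : Grid A | ε (z 0 0) = 0}
      add_mem' := by simp +contextual
      zero_mem' := by simp
      smul_mem' := by simp +contextual } ?_ ?_ ?_ ?_ ?_ ?_ z hz hz₀
  · exact g.smul_duv_dt_pow i _
  · exact g.dt_pow_dt_pow (i + 1)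
  · intro i z
    rcases neg_one_pow_eq_or ℤ i with h | h <;> simp [h, duv_apply, hu, hv]
  · intro i z hz hdz
    obtain ⟨y, hy⟩ := exists_duv_eq hg ((g.neg_one_pow_smul_duv_eq_zero_iff i z).1 hdz)
      (hg.exists_of_quotient_eq_zero hu hv ht hz)
    rcases neg_one_pow_eq_or ℤ i with h | h
    · exact ⟨y, by simp [h, hy]⟩
    · exact ⟨-y, by simp [h, hy]⟩
  · intro z hz _
    obtain ⟨y, hy⟩ := hg.exists_of_augmentation_eq_zero hu hv ht hεu hεv hεt hz
    refine ⟨Grid.single 0 0 y, (g.neg_one_pow_smul_duv_eq_zero_iff 1 _).2 (hd y), ?_⟩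
    change φ ((z - (g.dt ^ 1) (Grid.single 0 0 y)) 0 0) = 0
    rw [Grid.sub_apply, Finsupp.sub_apply, hδ, pow_one, hy]
  · intro i z _ hz
    obtain ⟨y, hy⟩ := hg.exists_of_quotient_mul_pow_eq_zero hu hv ht (exponent_add (i + 1))
      (z := z 0 0) (by
        rw [← dt_pow_apply]
        exact hz)
    refine ⟨Grid.single 0 0 y, (g.neg_one_pow_smul_duv_eq_zero_iff (i + 2) _).2 (hd y), ?_⟩
    change φ ((z - (g.dt ^ exponent p (i + 2)) (Grid.single 0 0 y)) 0 0) = 0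
    rw [Grid.sub_apply, Finsupp.sub_apply, hδ, hy]
  · intro z
    simp [duv_apply, hεu, hεv]
  · intro z
    change ε ((g.dt ^ 1) z 0 0) = 0
    simp [dt_apply_zero, hεt]

end Differentials

end SuperTriple

/-- A graded free resolution of the trivial module given by an augmentation `ε`, with basis indexed
by `I`, whose differential is given by a monomial matrix after applying `ε` to its entries. -/
structure MonomialResolution {k : Type} [Field k] {A : Type} [Ring A] [Algebra k A]
    (ε : A →ₐ[k] k) (I : Type) where
  /-- the degree of a basis element -/
  deg : I → ℕ
  finite_deg : ∀ n, {x | deg x = n}.Finite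
  /-- the unique basis element of degree zero -/
  base : I
  deg_eq_zero_iff : ∀ x, deg x = 0 ↔ x = base
  /-- the differential -/
  d : (I →₀ A) →ₗ[A] (I →₀ A)
  d_mem : ∀ n, ∀ z ∈ Finsupp.supported A A {x | deg x = n},
    d z ∈ Finsupp.supported A A {x | deg x + 1 = n}
  d_d : ∀ z, d (d z) = 0
  augmentation_d : ∀ z, ε (d z base) = 0
  exists_d_eq : ∀ z, d z = 0 → ε (z base) = 0 → ∃ y, d y = z
  /-- the coefficients of the monomial matrix obtained by applying `ε` to `d` -/
  coeff : I → k
  /-- the positions of the nonzero coefficients -/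
  target : I → I
  augmentation_d_single : ∀ x y,
    ε (d (Finsupp.single x 1) y) = Finsupp.single (target x) (coeff x) y
  target_injOn : Set.InjOn target {x | coeff x ≠ 0}

namespace SuperTriple

variable {k : Type} [Field k] {p : ℕ} {A : Type} [Ring A] [Algebra k A] (g : SuperTriple k p A)

lemma augmentation_dt_pow_apply {ε : A →ₐ[k] k} (hεt : ε g.t = 0) (n : ℕ) (z : Grid A)
    (a b : ℕ) : ε ((g.dt ^ n) z a b) = ε ((shift A ^ n) z a b) := by
  induction n generalizing a b with
  | zero => simp
  | succ n ih =>
    rw [pow_succ', pow_succ', Module.End.mul_apply, Module.End.mul_apply]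
    rcases b with _ | b
    · simp [dt_apply_zero, shift_apply_zero, hεt]
    · simp [dt_apply_succ, shift_apply_succ, hεt, ih]

/-- Triple sequences as sequences of double sequences. -/
noncomputable def gridEquiv (A : Type) [Ring A] : (ℕ × ℕ × ℕ →₀ A) ≃ₗ[A] (ℕ →₀ Grid A) :=
  Finsupp.curryLinearEquiv A ≪≫ₗ
    Finsupp.mapRange.linearEquiv (Finsupp.curryLinearEquiv (M := A) A : _ ≃ₗ[A] Grid A)

lemma gridEquiv_apply (z : ℕ × ℕ × ℕ →₀ A) (i a b : ℕ) : gridEquiv A z i a b = z (i, a, b) := rfl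

lemma gridEquiv_symm_apply (z : ℕ →₀ Grid A) (i a b : ℕ) :
    (gridEquiv A).symm z (i, a, b) = z i a b := by
  rw [← gridEquiv_apply, LinearEquiv.apply_symm_apply]

lemma gridEquiv_single (i a b : ℕ) (r : A) : gridEquiv A (Finsupp.single (i, a, b) r) =
    Finsupp.single i (Grid.single a b r) := by
  ext j a' b'
  rw [gridEquiv_apply]
  by_cases h : i = j
  · subst h
    simp [Finsupp.single_apply, Grid.single_apply]
  · simp [h]

lemma duvt_apply (z : ℕ →₀ Grid A) (i a b : ℕ) : g.duvt z i a b =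
    ((-1 : ℤ) ^ i • g.duv) (z i) a b + (g.dt ^ exponent p (i + 1)) (z (i + 1)) a b := by
  have := Totalization.total_apply (d := fun i => (-1 : ℤ) ^ i • g.duv)
    (δ := fun i => if i = 0 then 0 else g.dt ^ exponent p i) (if_pos rfl) z i
  rw [duvt, this]
  rfl

lemma dt_pow_apply_eq_zero {n : ℕ} {z : Grid A} (hz : ∀ a b, a + b ≠ n → z a b = 0) (m a b : ℕ)
    (h : a + b ≠ n) : (g.dt ^ m) z a b = 0 := by
  induction m generalizing a b with
  | zero => exact hz a b h
  | succ m ih =>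
    rw [pow_succ', Module.End.mul_apply]
    rcases b with _ | b
    · rw [dt_apply_zero, ih _ _ h, zero_mul]
    · rw [dt_apply_succ, ih _ _ h, ih _ _ (by omega), zero_mul, smul_zero, sub_zero]

lemma smul_duv_apply_eq_zero {n : ℕ} {z : Grid A} (hz : ∀ a b, a + b ≠ n → z a b = 0) (i a b : ℕ)
    (h : a + b + 1 ≠ n) : ((-1 : ℤ) ^ i • g.duv) z a b = 0 := by
  have : g.duv z a b = 0 := by
    rw [duv_apply, hz _ _ (by omega), hz _ _ (by omega), zero_mul, zero_mul, add_zero]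
  rcases neg_one_pow_eq_or ℤ i with h | h <;> simp [h, this]

lemma duvt_apply_eq_zero {n : ℕ} {z : ℕ →₀ Grid A} (hz : ∀ i a b, i + a + b ≠ n → z i a b = 0)
    (i a b : ℕ) (h : i + a + b + 1 ≠ n) : g.duvt z i a b = 0 := by
  rw [duvt_apply]
  rcases le_or_gt i n with hi | hi
  · rw [g.smul_duv_apply_eq_zero (n := n - i) (fun a b h => hz _ _ _ (by omega)) _ _ _ (by omega)]
    rcases hi.lt_or_eq with hi | hi
    · rw [g.dt_pow_apply_eq_zero (n := n - (i + 1)) (fun a b h => hz _ _ _ (by omega)) _ _ _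
        (by omega), add_zero]
    · have : z (i + 1) = 0 := by ext a b; exact hz _ _ _ (by omega)
      simp [this]
  · have h₁ : z i = 0 := by ext a b; exact hz _ _ _ (by omega)
    have h₂ : z (i + 1) = 0 := by ext a b; exact hz _ _ _ (by omega)
    simp [h₁, h₂]

/-- The resolution of the trivial module of the group algebra. -/
noncomputable def resolution [CharP k p] [Fact p.Prime] (hg : g.IsUniversal) {ε : A →ₐ[k] k}
    (hεu : ε g.u = 0) (hεv : ε g.v = 0) (hεt : ε g.t = 0) :
    MonomialResolution ε (ℕ × ℕ × ℕ) where
  deg x := x.1 + x.2.1 + x.2.2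
  finite_deg n := by
    refine (Set.finite_Iic ((n, n, n) : ℕ × ℕ × ℕ)).subset fun x hx => ?_
    simp only [Set.mem_ofPred_eq] at hx
    refine ⟨?_, ?_, ?_⟩ <;> dsimp only <;> omega
  base := (0, 0, 0)
  deg_eq_zero_iff := by
    rintro ⟨i, a, b⟩
    simp [and_assoc]
  d := (gridEquiv A).symm.toLinearMap ∘ₗ g.duvt ∘ₗ (gridEquiv A).toLinearMap
  d_mem n z hz := by
    rw [Finsupp.mem_supported'] at hz ⊢
    rintro ⟨i, a, b⟩ h
    exact (gridEquiv_symm_apply _ i a b).trans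
      (g.duvt_apply_eq_zero (fun i a b h => hz (i, a, b) h) i a b h)
  d_d z := by simp [duvt_duvt]
  augmentation_d z := by
    refine (congrArg ε (gridEquiv_symm_apply _ 0 0 0)).trans ?_
    simp [duvt_apply, duv_apply, hεu, hεv, dt_apply_zero, exponent, hεt]
  exists_d_eq z hz hz₀ := by
    obtain ⟨y, hy⟩ := exists_duvt_eq hg hεu hεv hεt (z := gridEquiv A z) (by simpa using hz) hz₀
    exact ⟨(gridEquiv A).symm y, by simp [hy]⟩
  coeff x := if x.1 = 0 ∨ x.2.1 < exponent p x.1 then 0 else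
    (-1) ^ exponent p x.1 * ((x.2.2 + 1).ascFactorial (exponent p x.1) : ℕ)
  target x := (x.1 - 1, x.2.1 - exponent p x.1, x.2.2 + exponent p x.1)
  augmentation_d_single := by
    rintro ⟨i, a, b⟩ ⟨i', a', b'⟩
    refine (congrArg ε (gridEquiv_symm_apply _ i' a' b')).trans ?_
    have h (w : Grid A) : ε (((-1 : ℤ) ^ i' • g.duv) w a' b') = 0 := by
      rcases neg_one_pow_eq_or ℤ i' with h | h <;> simp [h, duv_apply, hεu, hεv]
    rw [LinearMap.comp_apply, LinearEquiv.coe_coe, gridEquiv_single, duvt_apply, map_add, h,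
      zero_add, augmentation_dt_pow_apply g hεt]
    by_cases hi : i = i' + 1
    · subst hi
      simp [shift_pow_single]
      split_ifs with ha
      · simp
      · simp [Grid.single_apply, Finsupp.single_apply]
        split_ifs <;> simp
    · rw [Finsupp.single_eq_of_ne (by omega)]
      rcases eq_or_ne i 0 with rfl | hi₀
      · simp
      · rw [Finsupp.single_eq_of_ne]
        · simp
        · simp only [ne_eq, Prod.mk.injEq]
          omega
  target_injOn := by
    rintro ⟨i, a, b⟩ h ⟨i', a', b'⟩ h' hh
    simp at h h' hh
    obtain rfl : i = i' := by omega
    simp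
    omega

end SuperTriple

lemma CategoryTheory.ShortComplex.finrank_homology_add_finrank_range {k : Type} [Field k]
    (S : ShortComplex (ModuleCat k)) [Module.Finite k S.X₂] :
    Module.finrank k S.homology + Module.finrank k (LinearMap.range S.f.hom) +
      Module.finrank k (LinearMap.range S.g.hom) = Module.finrank k S.X₂ := by
  have h₁ : LinearMap.range S.f.hom ≤ LinearMap.ker S.g.hom :=
    LinearMap.range_le_ker_iff.2 (by rw [← ModuleCat.hom_comp, S.zero, ModuleCat.hom_zero])
  have h₂ : Module.finrank k S.homology = Module.finrank k
      (LinearMap.ker S.g.hom ⧸ (LinearMap.range S.f.hom).submoduleOf (LinearMap.ker S.g.hom)) := by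
    refine (S.moduleCatHomologyIso.toLinearEquiv.finrank_eq).trans ?_
    change Module.finrank k (LinearMap.ker S.g.hom ⧸ LinearMap.range S.moduleCatToCycles) = _
    rw [show LinearMap.range S.moduleCatToCycles = _ from LinearMap.range_codRestrict ..]
    rfl
  rw [h₂, ← (Submodule.submoduleOfEquivOfLe h₁).finrank_eq, Submodule.finrank_quotient_add_finrank,
    add_comm, LinearMap.finrank_range_add_finrank_ker]

lemma CochainComplex.finrank_homology_add {k : Type} [Field k]
    (K : CochainComplex (ModuleCat k) ℕ) (n : ℕ) [Module.Finite k (K.X n)] :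
    Module.finrank k (K.homology n) +
      Module.finrank k (LinearMap.range (K.d ((ComplexShape.up ℕ).prev n) n).hom) +
      Module.finrank k (LinearMap.range (K.d n (n + 1)).hom) = Module.finrank k (K.X n) := by
  have : Module.Finite k (K.sc n).X₂ := ‹_›
  have h := (K.sc n).finrank_homology_add_finrank_range
  change _ + _ +
    Module.finrank k (LinearMap.range (K.d n ((ComplexShape.up ℕ).next n)).hom) = _ at h
  rwa [CochainComplex.next] at h

/-- The transpose of a monomial matrix has as rank the number of nonzero coefficients. -/
lemma LinearMap.finrank_range_of_monomial {k V X Y : Type} [Field k] [AddCommGroup V] [Module k V]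
    [Module.Finite k V] [Finite X] (c : X → k) (τ : {x | c x ≠ 0} → Y)
    (hτ : Function.Injective τ) (T : (Y → V) →ₗ[k] (X → V))
    (hT₀ : ∀ f x, c x = 0 → T f x = 0) (hT : ∀ f x, T f x.1 = c x.1 • f (τ x)) :
    Module.finrank k (LinearMap.range T) = {x | c x ≠ 0}.ncard * Module.finrank k V := by
  let r : LinearMap.range T →ₗ[k] ({x | c x ≠ 0} → V) :=
    LinearMap.funLeft k V Subtype.val ∘ₗ Submodule.subtype _
  have hr : Function.Bijective r := by
    constructor
    · rw [injective_iff_map_eq_zero]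
      rintro ⟨_, f, rfl⟩ h
      ext x
      by_cases hx : c x = 0
      · exact hT₀ f x hx
      · exact congrFun h ⟨x, hx⟩
    · intro w
      refine ⟨⟨_, Function.extend τ (fun x => (c x.1)⁻¹ • w x) 0, rfl⟩, ?_⟩
      ext x
      change T _ x.1 = _
      rw [hT, hτ.extend_apply, smul_inv_smul₀ x.2]
  have := Fintype.ofFinite {x | c x ≠ 0}
  rw [(LinearEquiv.ofBijective r hr).finrank_eq, Module.finrank_pi_fintype, Finset.sum_const,
    Finset.card_univ, ← Nat.card_eq_fintype_card, Nat.card_coe_set_eq, smul_eq_mul]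

namespace MonomialResolution

variable {k : Type} [Field k] {A : Type} [Ring A] [Algebra k A] {ε : A →ₐ[k] k} {I : Type}
  (R : MonomialResolution ε I)

/-- The inclusion of the degree `n` part. -/
noncomputable def incl (n : ℕ) : ({x // R.deg x = n} →₀ A) →ₗ[A] (I →₀ A) :=
  Finsupp.lmapDomain A A Subtype.val

lemma incl_injective (n : ℕ) : Function.Injective (R.incl (A := A) n) :=
  Finsupp.mapDomain_injective Subtype.val_injective

lemma incl_apply {n : ℕ} (z : {x // R.deg x = n} →₀ A) (x : {x // R.deg x = n}) :
    R.incl n z x = z x :=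
  Finsupp.mapDomain_apply Subtype.val_injective _ _

lemma range_incl (n : ℕ) :
    LinearMap.range (R.incl n) = Finsupp.supported A A {x | R.deg x = n} := by
  rw [incl, Finsupp.range_lmapDomain, Finsupp.supported_eq_span_single]
  congr 1
  ext
  simp

lemma incl_mem {n : ℕ} (z : {x // R.deg x = n} →₀ A) :
    R.incl n z ∈ Finsupp.supported A A {x | R.deg x = n} :=
  R.range_incl n ▸ LinearMap.mem_range_self _ z

/-- The differential from degree `n + 1` to degree `n`. -/
noncomputable def dFrom (n : ℕ) :
    ({x // R.deg x = n + 1} →₀ A) →ₗ[A] ({x // R.deg x = n} →₀ A) :=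
  Finsupp.lsubtypeDomain {x | R.deg x = n} ∘ₗ R.d ∘ₗ R.incl (n + 1)

lemma dFrom_apply {n : ℕ} (z : {x // R.deg x = n + 1} →₀ A) (x : {x // R.deg x = n}) :
    R.dFrom n z x = R.d (R.incl (n + 1) z) x := rfl

lemma incl_dFrom (n : ℕ) (z : {x // R.deg x = n + 1} →₀ A) :
    R.incl n (R.dFrom n z) = R.d (R.incl (n + 1) z) := by
  have h := R.d_mem (n + 1) _ (R.incl_mem z)
  simp only [add_left_inj] at h
  rw [← range_incl] at h
  obtain ⟨w, hw⟩ := h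
  rw [← hw]
  congr 1
  ext x
  rw [dFrom_apply, ← hw, incl_apply]

/-- An element with homogeneous boundary has the same boundary as its homogeneous part. -/
lemma exists_dFrom_eq {n : ℕ} {z : {x // R.deg x = n} →₀ A} {y : I →₀ A}
    (hy : R.d y = R.incl n z) : ∃ w, R.dFrom n w = z := by
  classical
  have hsplit := Finsupp.filter_add_filter_not y fun x => R.deg x = n + 1
  obtain ⟨w, hw⟩ : y.filter (fun x => R.deg x = n + 1) ∈ LinearMap.range (R.incl (n + 1)) := by
    rw [range_incl, Finsupp.mem_supported']
    exact fun x hx => Finsupp.filter_apply_neg _ _ hx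
  refine ⟨w, ?_⟩
  ext x
  suffices h : R.d (y.filter fun x => ¬ R.deg x = n + 1) x = 0 by
    rw [dFrom_apply, ← incl_apply, ← hy, hw, ← hsplit, map_add, Finsupp.add_apply, h, add_zero,
      hsplit]
  set y' := y.filter fun x => ¬ R.deg x = n + 1 with hy'
  rw [← Finsupp.sum_single y', Finsupp.sum, map_sum, Finsupp.finsetSum_apply]
  refine Finset.sum_eq_zero fun a ha => ?_
  rw [Finsupp.support_filter, Finset.mem_filter] at ha
  exact (Finsupp.mem_supported' A _).1
    (R.d_mem (R.deg a) _ (Finsupp.single_mem_supported A _ rfl)) x fun h =>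
      ha.2 (by rw [← h, x.2])

lemma dFrom_dFrom (n : ℕ) : R.dFrom n ∘ₗ R.dFrom (n + 1) = 0 := by
  ext1 x
  refine LinearMap.ext fun r => R.incl_injective n ?_
  simp [incl_dFrom, R.d_d]

lemma range_dFrom (n : ℕ) : LinearMap.range (R.dFrom (n + 1)) = LinearMap.ker (R.dFrom n) := by
  refine le_antisymm (LinearMap.range_le_ker_iff.2 (R.dFrom_dFrom n)) fun z hz => ?_
  obtain ⟨y, hy⟩ := R.exists_d_eq (R.incl (n + 1) z)
    (by rw [← incl_dFrom, LinearMap.mem_ker.1 hz, map_zero]) (by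
      rw [(Finsupp.mem_supported' A _).1 (R.incl_mem z) R.base, map_zero]
      simp [(R.deg_eq_zero_iff R.base).2 rfl])
  exact R.exists_dFrom_eq hy

/-- The chain complex of free modules underlying the resolution. -/
noncomputable def complex : ChainComplex (ModuleCat A) ℕ :=
  ChainComplex.of (fun n => ModuleCat.of A ({x // R.deg x = n} →₀ A))
    (fun n => ModuleCat.ofHom (R.dFrom n)) fun n => by
      rw [← ModuleCat.ofHom_comp, dFrom_dFrom]
      rfl

lemma complex_d (n : ℕ) : R.complex.d (n + 1) n = ModuleCat.ofHom (R.dFrom n) :=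
  ChainComplex.of_d (fun n => ModuleCat.of A ({x // R.deg x = n} →₀ A))
    (fun n => ModuleCat.ofHom (R.dFrom n)) n

variable [Module A k] (hε : ∀ (a : A) (c : k), a • c = ε a * c)

/-- The augmentation of the resolution. -/
noncomputable def aug : ({x // R.deg x = 0} →₀ A) →ₗ[A] k :=
  LinearMap.toSpanSingleton A k 1 ∘ₗ
    Finsupp.lapply (⟨R.base, (R.deg_eq_zero_iff _).2 rfl⟩ : {x // R.deg x = 0})

include hε in
lemma aug_apply (z : {x // R.deg x = 0} →₀ A) : R.aug z = ε (R.incl 0 z R.base) := by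
  rw [R.incl_apply z ⟨R.base, (R.deg_eq_zero_iff _).2 rfl⟩]
  simp [aug, hε]

include hε in
lemma aug_surjective : Function.Surjective R.aug := fun c => by
  refine ⟨Finsupp.single ⟨R.base, (R.deg_eq_zero_iff _).2 rfl⟩ (algebraMap k A c), ?_⟩
  simp [aug, hε]

include hε in
lemma range_dFrom_zero : LinearMap.range (R.dFrom 0) = LinearMap.ker R.aug := by
  apply le_antisymm
  · rintro _ ⟨z, rfl⟩
    rw [LinearMap.mem_ker, R.aug_apply hε, incl_dFrom, R.augmentation_d]
  · intro z hz
    rw [LinearMap.mem_ker, R.aug_apply hε] at hz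
    have h := R.d_mem 0 _ (R.incl_mem z)
    simp only [Nat.add_eq_zero_iff, one_ne_zero, and_false, Set.ofPred_false,
      Finsupp.supported_empty, Submodule.mem_bot] at h
    obtain ⟨y, hy⟩ := R.exists_d_eq _ h hz
    exact R.exists_dFrom_eq hy

include hε in
lemma complex_d_comp_aug :
    R.complex.d 1 0 ≫ (ModuleCat.ofHom R.aug : R.complex.X 0 ⟶ ModuleCat.of A k) = 0 := by
  rw [complex_d]
  refine (ModuleCat.ofHom_comp _ _).symm.trans ?_
  rw [LinearMap.range_le_ker_iff.1 (R.range_dFrom_zero hε).le]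
  rfl

/-- The augmentation of the resolution as a map of chain complexes. -/
noncomputable def augHom : R.complex ⟶ (ChainComplex.single₀ _).obj (ModuleCat.of A k) :=
  (ChainComplex.toSingle₀Equiv _ _).symm ⟨ModuleCat.ofHom R.aug, R.complex_d_comp_aug hε⟩

lemma augHom_f_zero : (R.augHom hε).f 0 = ModuleCat.ofHom R.aug :=
  ChainComplex.toSingle₀Equiv_symm_apply_f_zero _ _

lemma quasiIso_augHom : QuasiIso (R.augHom hε) where
  quasiIsoAt m := by
    induction m with
    | zero =>
      rw [ChainComplex.quasiIsoAt₀_iff, ShortComplex.quasiIso_iff_of_zeros' _ rfl rfl rfl]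
      constructor
      · rw [ShortComplex.moduleCat_exact_iff_range_eq_ker]
        change LinearMap.range (R.complex.d 1 0).hom = LinearMap.ker ((R.augHom hε).f 0).hom
        rw [complex_d, augHom_f_zero]
        exact R.range_dFrom_zero hε
      · change Epi ((R.augHom hε).f 0)
        rw [augHom_f_zero]
        exact (ModuleCat.epi_iff_surjective (ModuleCat.ofHom R.aug)).2 (R.aug_surjective hε)
    | succ m _ =>
      rw [quasiIsoAt_iff_exactAt' (hL := ChainComplex.exactAt_succ_single_obj ..),
        HomologicalComplex.exactAt_iff' _ (m + 2) (m + 1) m (by simp) (by simp),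
        ShortComplex.moduleCat_exact_iff_range_eq_ker]
      change LinearMap.range (R.complex.d (m + 2) (m + 1)).hom =
        LinearMap.ker (R.complex.d (m + 1) m).hom
      rw [complex_d, complex_d]
      exact R.range_dFrom m

/-- The projective resolution of the trivial module. -/
noncomputable def projectiveResolution : ProjectiveResolution (ModuleCat.of A k) where
  complex := R.complex
  projective n := inferInstanceAs <| Projective (ModuleCat.of A ({x // R.deg x = n} →₀ A))
  π := R.augHom hε
  quasiIso := R.quasiIso_augHom hε

end MonomialResolution

lemma LinearMap.finrank_range_conj {k V W V' W' : Type} [Field k] [AddCommGroup V]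
    [AddCommGroup W] [AddCommGroup V'] [AddCommGroup W'] [Module k V] [Module k W] [Module k V']
    [Module k W'] (f : V →ₗ[k] W) (e : V ≃ₗ[k] V') (e' : W ≃ₗ[k] W') :
    Module.finrank k (LinearMap.range (e'.toLinearMap ∘ₗ f ∘ₗ e.symm.toLinearMap)) =
      Module.finrank k (LinearMap.range f) := by
  rw [LinearMap.range_comp, LinearEquiv.finrank_map_eq, LinearMap.range_comp,
    LinearEquiv.range, Submodule.map_top]

namespace MonomialResolution

variable {k : Type} [Field k] {A : Type} [Ring A] [Algebra k A] {ε : A →ₐ[k] k} {I : Type}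
  (R : MonomialResolution ε I)

lemma deg_target {x : I} (hx : R.coeff x ≠ 0) : R.deg (R.target x) + 1 = R.deg x := by
  by_contra h
  have h₁ := R.augmentation_d_single x (R.target x)
  rw [(Finsupp.mem_supported' A _).1 (R.d_mem (R.deg x) _ (Finsupp.single_mem_supported A _ rfl))
    _ h, map_zero, Finsupp.single_eq_same] at h₁
  exact hx h₁.symm

open scoped ModuleCat

variable (V : ModuleCat.{0} A)

/-- Homomorphisms to a module in terms of the basis of the resolution. -/
noncomputable def homEquiv (n : ℕ) :
    (R.complex.X n ⟶ V) ≃ₗ[k] ({x // R.deg x = n} → V) :=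
  ModuleCat.homLinearEquiv (M := ModuleCat.of A ({x // R.deg x = n} →₀ A)) ≪≫ₗ
    (Finsupp.llift V A k {x // R.deg x = n}).symm

variable {V}

lemma homEquiv_apply {n : ℕ} (f : R.complex.X n ⟶ V) (x : {x // R.deg x = n}) :
    R.homEquiv V n f x = f.hom (Finsupp.single x 1 : {x // R.deg x = n} →₀ A) := rfl

lemma hom_apply {n : ℕ} (f : R.complex.X n ⟶ V) (z : {x // R.deg x = n} →₀ A) :
    f.hom z = z.sum fun x a => a • R.homEquiv V n f x := by
  conv_lhs => rw [← z.sum_single]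
  refine (map_finsuppSum (f.hom : ({x // R.deg x = n} →₀ A) →ₗ[A] V) _ _).trans ?_
  refine Finsupp.sum_congr fun x _ => ?_
  rw [homEquiv_apply]
  refine Eq.trans ?_ ((f.hom : ({x // R.deg x = n} →₀ A) →ₗ[A] V).map_smul (z x) _)
  exact congrArg (f.hom : ({x // R.deg x = n} →₀ A) →ₗ[A] V) (Finsupp.smul_single_one x (z x)).symm

variable (hV : ∀ (a : A) (v : V), a • v = ε a • v)

include hV in
lemma homEquiv_complex_d (n : ℕ) (f : R.complex.X n ⟶ V)
    (x : {x // R.deg x = n + 1}) : R.homEquiv V (n + 1) (R.complex.d (n + 1) n ≫ f) x =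
      if h : R.deg (R.target x) = n then R.coeff x • R.homEquiv V n f ⟨_, h⟩ else 0 := by
  rw [homEquiv_apply, complex_d]
  refine (R.hom_apply f (R.dFrom n (Finsupp.single x 1))).trans ?_
  have h (y : {x // R.deg x = n}) : R.dFrom n (Finsupp.single x 1) y • R.homEquiv V n f y =
      Finsupp.single (R.target x) (R.coeff x) y.1 • R.homEquiv V n f y := by
    rw [hV, dFrom_apply, incl, Finsupp.lmapDomain_apply, Finsupp.mapDomain_single,
      augmentation_d_single]
  simp only [Finsupp.sum, h]
  split_ifs with ht
  · rw [Finset.sum_eq_single ⟨_, ht⟩]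
    · simp
    · intro y _ hy
      rw [Finsupp.single_eq_of_ne (fun h => hy (Subtype.ext h)), zero_smul]
    · intro hy
      rw [Finsupp.notMem_support_iff] at hy
      rw [← h, hy, zero_smul]
  · refine Finset.sum_eq_zero fun y _ => ?_
    rw [Finsupp.single_eq_of_ne, zero_smul]
    rintro h
    exact ht (h ▸ y.2)

instance (n : ℕ) : Finite {x // R.deg x = n} := R.finite_deg n

variable [Module.Finite k V]

include hV in
lemma finrank_range_d (n : ℕ) :
    Module.finrank k (LinearMap.range ((R.complex.linearYonedaObj k V).d n (n + 1)).hom) =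
      {x | R.deg x = n + 1 ∧ R.coeff x ≠ 0}.ncard * Module.finrank k V := by
  let T : ({x // R.deg x = n} → V) →ₗ[k] ({x // R.deg x = n + 1} → V) :=
    (R.homEquiv V (n + 1)).toLinearMap ∘ₗ
      ((R.complex.linearYonedaObj k V).d n (n + 1)).hom ∘ₗ (R.homEquiv V n).symm.toLinearMap
  have hT f (x : {x // R.deg x = n + 1}) : T f x =
      if h : R.deg (R.target x) = n then R.coeff x • f ⟨_, h⟩ else 0 := by
    refine (R.homEquiv_complex_d hV n ((R.homEquiv V n).symm f) x).trans ?_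
    rw [LinearEquiv.apply_symm_apply]
  have hdeg (x : {x : {x // R.deg x = n + 1} | R.coeff x ≠ 0}) : R.deg (R.target x.1) = n := by
    have := R.deg_target x.2
    have := x.1.2
    omega
  have h := LinearMap.finrank_range_of_monomial (fun x : {x // R.deg x = n + 1} => R.coeff x)
    (fun x => (⟨R.target x.1, hdeg x⟩ : {x // R.deg x = n}))
    (fun x y hxy => Subtype.ext (Subtype.ext (R.target_injOn x.2 y.2 (congrArg Subtype.val hxy))))
    T (fun f x hx => by rw [hT]; simp [hx]) (fun f x => by rw [hT, dif_pos (hdeg x)])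
  have hcard : {x : {x // R.deg x = n + 1} | R.coeff x ≠ 0}.ncard =
      {x | R.deg x = n + 1 ∧ R.coeff x ≠ 0}.ncard := by
    rw [← Set.ncard_image_of_injective _ Subtype.val_injective]
    congr 1
    ext x
    simp [and_comm]
  rw [← hcard, ← h]
  exact (LinearMap.finrank_range_conj _ _ _).symm

include hV in
lemma finrank_range_d_prev (n : ℕ) :
    Module.finrank k (LinearMap.range
      ((R.complex.linearYonedaObj k V).d ((ComplexShape.up ℕ).prev n) n).hom) =
      {x | R.deg x = n ∧ R.coeff x ≠ 0}.ncard * Module.finrank k V := by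
  rcases n with _ | n
  · have : {x | R.deg x = 0 ∧ R.coeff x ≠ 0} = ∅ :=
      Set.eq_empty_of_forall_notMem fun x h => by have := R.deg_target h.2; have := h.1; omega
    rw [this, HomologicalComplex.shape _ _ _ (by simp), ModuleCat.hom_zero, LinearMap.range_zero]
    simp
  · rw [CochainComplex.prev_nat_succ, R.finrank_range_d hV]

include hV in
lemma finrank_homology (n : ℕ) :
    Module.finrank k ((R.complex.linearYonedaObj k V).homology n) +
      {x | R.deg x = n ∧ R.coeff x ≠ 0}.ncard * Module.finrank k V +
      {x | R.deg x = n + 1 ∧ R.coeff x ≠ 0}.ncard * Module.finrank k V =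
    {x | R.deg x = n}.ncard * Module.finrank k V := by
  have : Module.Finite k ((R.complex.linearYonedaObj k V).X n) :=
    Module.Finite.equiv (R.homEquiv V n).symm
  have h := CochainComplex.finrank_homology_add (R.complex.linearYonedaObj k V) n
  rw [R.finrank_range_d hV, R.finrank_range_d_prev hV] at h
  rw [h]
  refine (R.homEquiv V n).finrank_eq.trans ?_
  have := Fintype.ofFinite {x // R.deg x = n}
  rw [Module.finrank_pi_fintype, Finset.sum_const, Finset.card_univ, ← Nat.card_eq_fintype_card,
    smul_eq_mul]
  rfl

omit [Module.Finite k V] in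
include hV in
lemma finrank_homology_of_addEquiv (e : V ≃+ k) (he : ∀ (c : k) (v : V), e (c • v) = c * e v)
    (n : ℕ) :
    Module.finrank k ((R.complex.linearYonedaObj k V).homology n) +
      {x | R.deg x = n ∧ R.coeff x ≠ 0}.ncard + {x | R.deg x = n + 1 ∧ R.coeff x ≠ 0}.ncard =
    {x | R.deg x = n}.ncard := by
  let e' : V ≃ₗ[k] k := { e with map_smul' := he }
  have : Module.Finite k V := .equiv e'.symm
  simpa [e'.finrank_eq] using R.finrank_homology hV n

/-- The dimension of `Ext` from the trivial module to itself. -/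
lemma finrank_ext [Module A k] (hε : ∀ (a : A) (c : k), a • c = ε a * c) (n : ℕ) :
    Module.finrank k (((Ext k (ModuleCat A) n).obj
      (Opposite.op (ModuleCat.of A k))).obj (ModuleCat.of A k)) +
      {x | R.deg x = n ∧ R.coeff x ≠ 0}.ncard + {x | R.deg x = n + 1 ∧ R.coeff x ≠ 0}.ncard =
    {x | R.deg x = n}.ncard := by
  have hsmul (c v : k) : (ModuleCat.of A k).moduleOfAlgebraModule.smul c v = c * v :=
    (hε _ _).trans (by simp)
  have h := R.finrank_homology_of_addEquiv (V := ModuleCat.of A k)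
    (fun a v => (hε a v).trans (hsmul _ _).symm)
    (AddEquiv.refl k) hsmul n
  rw [← h, ((R.projectiveResolution hε).isoExt (R := k) n _).toLinearEquiv.finrank_eq]
  rfl

end MonomialResolution

lemma Nat.Prime.dvd_ascFactorial_pred_iff {p : ℕ} (hp : p.Prime) (b : ℕ) :
    p ∣ (b + 1).ascFactorial (p - 1) ↔ ¬ p ∣ b := by
  rw [Nat.ascFactorial_eq_prod_range, hp.prime.dvd_finsetProd_iff]
  constructor
  · rintro ⟨j, hj, h⟩ hb
    rw [add_assoc, Nat.dvd_add_right hb] at h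
    have := Nat.le_of_dvd (by omega) h
    have := hp.pos
    rw [Finset.mem_range] at hj
    omega
  · intro hb
    have h₁ : b % p ≠ 0 := fun h => hb (Nat.dvd_of_mod_eq_zero h)
    have h₂ := Nat.mod_lt b hp.pos
    refine ⟨p - b % p - 1, Finset.mem_range.2 (by omega), b / p + 1, ?_⟩
    have := Nat.div_add_mod b p
    rw [mul_add, mul_one]
    omega

section Counting

open scoped Finset

/-- Counting triples of given sum by the sum of the last two entries. -/
lemma ncard_triples (P : ℕ → ℕ → ℕ → Prop) [∀ i a b, Decidable (P i a b)] (n : ℕ) :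
    {x : ℕ × ℕ × ℕ | x.1 + x.2.1 + x.2.2 = n ∧ P x.1 x.2.1 x.2.2}.ncard =
      ∑ j ∈ Finset.range (n + 1), #{b ∈ Finset.range (j + 1) | P (n - j) (j - b) b} := by
  rw [← Finset.card_sigma, ← Finset.card_image_of_injOn
    (f := fun y : (_ : ℕ) × ℕ => ((n - y.1, y.1 - y.2, y.2) : ℕ × ℕ × ℕ)), ← Set.ncard_coe_finset]
  · congr 1
    ext ⟨i, a, b⟩
    simp only [Set.mem_ofPred_eq, Finset.coe_image, Set.mem_image, Finset.mem_coe,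
      Finset.mem_sigma, Finset.mem_filter, Finset.mem_range, Prod.mk.injEq]
    constructor
    · rintro ⟨rfl, h⟩
      refine ⟨⟨a + b, b⟩, ⟨?_, ?_, ?_⟩, ?_, ?_, rfl⟩
      · dsimp only; omega
      · dsimp only; omega
      · convert h using 1 <;> dsimp only <;> omega
      · dsimp only; omega
      · dsimp only; omega
    · rintro ⟨⟨j, b⟩, ⟨hj, hb, h⟩, rfl, rfl, rfl⟩
      refine ⟨?_, h⟩
      dsimp only at *
      omega
  · rintro ⟨j, b⟩ h ⟨j', b'⟩ h' hh
    simp only [Finset.mem_coe, Finset.mem_sigma, Finset.mem_filter, Finset.mem_range,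
      Prod.mk.injEq] at h h' hh
    obtain rfl : j = j' := by omega
    obtain rfl : b = b' := by omega
    rfl

/-- The number of pairs of sum `j` with a nonzero coefficient in odd columns. -/
lemma card_filter_not_dvd_succ (p j : ℕ) :
    #{b ∈ Finset.range (j + 1) | 1 ≤ j - b ∧ ¬ p ∣ b + 1} + j / p = j := by
  rw [← Nat.card_multiples]
  have : {b ∈ Finset.range (j + 1) | 1 ≤ j - b ∧ ¬ p ∣ b + 1} =
      {b ∈ Finset.range j | ¬ p ∣ b + 1} := by
    ext b
    simp only [Finset.mem_filter, Finset.mem_range]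
    omega
  rw [this, add_comm, Finset.card_filter_add_card_filter_not, Finset.card_range]

/-- The number of pairs of sum `j` with a nonzero coefficient in positive even columns. -/
lemma card_filter_dvd {p : ℕ} (hp : 0 < p) (j : ℕ) :
    #{b ∈ Finset.range (j + 1) | p - 1 ≤ j - b ∧ p ∣ b} = (j + 1) / p := by
  rw [← Nat.card_multiples]
  refine Finset.card_bij' (fun b _ => b + p - 1) (fun e _ => e + 1 - p) ?_ ?_ ?_ ?_
  · intro b hb
    simp only [Finset.mem_filter, Finset.mem_range] at hb ⊢
    rw [show b + p - 1 + 1 = b + p by omega]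
    exact ⟨by omega, by simp [hb.2.2]⟩
  · intro e he
    simp only [Finset.mem_filter, Finset.mem_range] at he ⊢
    have := Nat.le_of_dvd (by omega) he.2
    exact ⟨by omega, by omega, Nat.dvd_sub he.2 dvd_rfl⟩
  · intro b _
    omega
  · intro e he
    simp only [Finset.mem_filter, Finset.mem_range] at he
    have := Nat.le_of_dvd (by omega) he.2
    omega

end Counting

namespace SuperTriple

variable {k : Type} [Field k] {p : ℕ} {A : Type} [Ring A] [Algebra k A] (g : SuperTriple k p A)

lemma resolution_coeff_ne_zero [CharP k p] [Fact p.Prime] (hg : g.IsUniversal) {ε : A →ₐ[k] k}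
    (hεu : ε g.u = 0) (hεv : ε g.v = 0) (hεt : ε g.t = 0) (x : ℕ × ℕ × ℕ) :
    (g.resolution hg hεu hεv hεt).coeff x ≠ 0 ↔
      x.1 ≠ 0 ∧ if Odd x.1 then 1 ≤ x.2.1 ∧ ¬ p ∣ x.2.2 + 1 else p - 1 ≤ x.2.1 ∧ p ∣ x.2.2 := by
  change (if x.1 = 0 ∨ x.2.1 < exponent p x.1 then 0 else
    (-1) ^ exponent p x.1 * ((x.2.2 + 1).ascFactorial (exponent p x.1) : k)) ≠ 0 ↔ _
  rcases eq_or_ne x.1 0 with h₀ | h₀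
  · simp [h₀]
  rcases lt_or_ge x.2.1 (exponent p x.1) with h₁ | h₁
  · rw [if_pos (.inr h₁)]
    rw [exponent] at h₁
    split_ifs at h₁ ⊢
    · simp [h₁]
    · simp [h₁.not_ge]
  · rw [if_neg (by omega), mul_ne_zero_iff,
      and_iff_right (pow_ne_zero _ (neg_ne_zero.2 one_ne_zero)), ne_eq, CharP.cast_eq_zero_iff k p, and_iff_right h₀]
    rw [exponent] at h₁ ⊢
    split_ifs at h₁ ⊢ with h
    · rw [Nat.ascFactorial_succ, Nat.ascFactorial_zero, mul_one, add_zero, and_iff_right h₁]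
    · rw [(Fact.out : p.Prime).dvd_ascFactorial_pred_iff, not_not, and_iff_right h₁]

lemma ncard_coeff_ne_zero [CharP k p] [Fact p.Prime] (hg : g.IsUniversal) {ε : A →ₐ[k] k}
    (hεu : ε g.u = 0) (hεv : ε g.v = 0) (hεt : ε g.t = 0) (n : ℕ) :
    {x | (g.resolution hg hεu hεv hεt).deg x = n ∧
      (g.resolution hg hεu hεv hεt).coeff x ≠ 0}.ncard =
    ∑ j ∈ Finset.range n, if Odd (n - j) then j - j / p else (j + 1) / p := by
  simp only [resolution_coeff_ne_zero]
  change {x : ℕ × ℕ × ℕ | x.1 + x.2.1 + x.2.2 = n ∧ (x.1 ≠ 0 ∧ if Odd x.1 then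
      1 ≤ x.2.1 ∧ ¬ p ∣ x.2.2 + 1 else p - 1 ≤ x.2.1 ∧ p ∣ x.2.2)}.ncard = _
  rw [ncard_triples fun i a b => i ≠ 0 ∧ if Odd i then 1 ≤ a ∧ ¬ p ∣ b + 1 else p - 1 ≤ a ∧ p ∣ b,
    Finset.sum_range_succ, tsub_self]
  simp only [ne_eq, not_true_eq_false, false_and, Finset.filter_false, Finset.card_empty, add_zero]
  refine Finset.sum_congr rfl fun j hj => ?_
  have hnj : n - j ≠ 0 := by have := Finset.mem_range.1 hj; omega
  have hp := (Fact.out : p.Prime).pos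
  split_ifs with h
  · have := card_filter_not_dvd_succ p j
    simp only [hnj, not_false_eq_true, true_and]
    omega
  · simp only [hnj, not_false_eq_true, true_and]
    exact card_filter_dvd hp j

lemma ncard_deg [CharP k p] [Fact p.Prime] (hg : g.IsUniversal) {ε : A →ₐ[k] k}
    (hεu : ε g.u = 0) (hεv : ε g.v = 0) (hεt : ε g.t = 0) (n : ℕ) :
    {x | (g.resolution hg hεu hεv hεt).deg x = n}.ncard = ∑ j ∈ Finset.range (n + 1), (j + 1) := by
  have := ncard_triples (fun _ _ _ => True) n
  simpa using! this

lemma ncard_deg_eq [CharP k p] [Fact p.Prime] (hg : g.IsUniversal) {ε : A →ₐ[k] k}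
    (hεu : ε g.u = 0) (hεv : ε g.v = 0) (hεt : ε g.t = 0) (n : ℕ) :
    n + 1 + {x | (g.resolution hg hεu hεv hεt).deg x = n ∧
      (g.resolution hg hεu hεv hεt).coeff x ≠ 0}.ncard +
    {x | (g.resolution hg hεu hεv hεt).deg x = n + 1 ∧
      (g.resolution hg hεu hεv hεt).coeff x ≠ 0}.ncard =
    {x | (g.resolution hg hεu hεv hεt).deg x = n}.ncard := by
  rw [ncard_coeff_ne_zero, ncard_coeff_ne_zero, ncard_deg, Finset.sum_range_succ,
    add_tsub_cancel_left, if_pos odd_one, add_assoc, ← add_assoc (Finset.sum _ _),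
    ← Finset.sum_add_distrib]
  have h : ∀ j ∈ Finset.range n, ((if Odd (n - j) then j - j / p else (j + 1) / p) +
      if Odd (n + 1 - j) then j - j / p else (j + 1) / p) = j - j / p + (j + 1) / p := by
    intro j hj
    have : n + 1 - j = n - j + 1 := by have := Finset.mem_range.1 hj; omega
    simp only [this, Nat.odd_add_one]
    split_ifs <;> omega
  rw [Finset.sum_congr rfl h]
  clear h
  induction n with
  | zero => simp
  | succ n ih =>
    rw [Finset.sum_range_succ, Finset.sum_range_succ _ (n + 1), ← ih]
    have h₁ := Nat.div_le_self n p
    have h₂ := Nat.div_le_self (n + 1) p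
    omega

/-- The cohomology of an algebra generated by a universal triple has dimensions `n + 1`. -/
theorem IsUniversal.finrank_ext [CharP k p] [Fact p.Prime] {g : SuperTriple k p A}
    (hg : g.IsUniversal) {ε : A →ₐ[k] k} (hεu : ε g.u = 0) (hεv : ε g.v = 0) (hεt : ε g.t = 0)
    [Module A k] (hε : ∀ (a : A) (c : k), a • c = ε a * c) (n : ℕ) :
    Module.finrank k (((Ext k (ModuleCat A) n).obj
      (Opposite.op (ModuleCat.of A k))).obj (ModuleCat.of A k)) = n + 1 := by
  have h := (g.resolution hg hεu hεv hεt).finrank_ext hε n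
  have h' := g.ncard_deg_eq hg hεu hεv hεt n
  omega

end SuperTriple

namespace SuperAlg

variable (k : Type) [Field k] (p : ℕ)

/-- The generators of the group algebra. -/
noncomputable def generators : SuperTriple k p (SuperAlg k p) where
  u := RingQuot.mkAlgHom k (SuperRel k p) (FreeAlgebra.ι k 0)
  v := RingQuot.mkAlgHom k (SuperRel k p) (FreeAlgebra.ι k 1)
  t := RingQuot.mkAlgHom k (SuperRel k p) (FreeAlgebra.ι k 2)
  u_mul_u := by simpa using RingQuot.mkAlgHom_rel k (SuperRel.uu (k := k) (p := p))
  v_mul_v := by simpa using RingQuot.mkAlgHom_rel k (SuperRel.vv (k := k) (p := p))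
  u_mul_v := by simpa using RingQuot.mkAlgHom_rel k (SuperRel.uv (k := k) (p := p))
  t_pow := by simpa using RingQuot.mkAlgHom_rel k (SuperRel.tp (k := k) (p := p))
  t_mul_v := by simpa using RingQuot.mkAlgHom_rel k (SuperRel.tv (k := k) (p := p))
  t_mul_u := by simpa using RingQuot.mkAlgHom_rel k (SuperRel.tu (k := k) (p := p))

lemma adjoin_generators : Algebra.adjoin k
    {(generators k p).u, (generators k p).v, (generators k p).t} = ⊤ := by
  refine top_le_iff.1 fun a _ => ?_
  obtain ⟨x, rfl⟩ := RingQuot.mkAlgHom_surjective k (SuperRel k p) a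
  induction x using FreeAlgebra.induction with
  | grade0 r => rw [AlgHom.commutes]; exact Subalgebra.algebraMap_mem _ r
  | grade1 i =>
    refine Algebra.subset_adjoin ?_
    fin_cases i
    · exact .inl rfl
    · exact .inr (.inl rfl)
    · exact .inr (.inr rfl)
  | mul x y hx hy => rw [map_mul]; exact mul_mem (hx trivial) (hy trivial)
  | add x y hx hy => rw [map_add]; exact add_mem (hx trivial) (hy trivial)

lemma isUniversal_generators : (generators k p).IsUniversal where
  adjoin_eq_top := adjoin_generators k p
  exists_lift B _ _ h := by
    refine ⟨RingQuot.liftAlgHom k ⟨FreeAlgebra.lift k ![h.u, h.v, h.t], fun x y hxy => ?_⟩,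
      ?_, ?_, ?_⟩
    · induction hxy <;> simp [h.u_mul_u, h.v_mul_v, h.u_mul_v, h.t_pow, h.t_mul_v, h.t_mul_u]
    all_goals simp [generators]

end SuperAlg

/-- Let `k` be a field of odd characteristic `p` and
`A = k[u,v,t]/(u², v², uv+vu, t^p, tv-vt, tu-ut-v)` the group algebra of
`G = (G_a⁻ × G_a⁻) ⋊ G_{a(1)}`.  Then `dim_k Extⁿ_A(k,k) = n + 1` for all `n ≥ 0`, i.e. the
Poincaré series of the cohomology of `G` is `1/(1-t)²`. -/
theorem ext_dimension_superalgebra (p : ℕ) [Fact p.Prime] (hp : Odd p)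
    (k : Type) [Field k] [CharP k p] (n : ℕ) :
    Module.finrank k
      (((Ext k (ModuleCat (SuperAlg k p)) n).obj
          (Opposite.op (ModuleCat.of (SuperAlg k p) k))).obj
        (ModuleCat.of (SuperAlg k p) k)) = n + 1 :=
  (SuperAlg.isUniversal_generators k p).finrank_ext (ε := superAug k p)
    (by simp [superAug, SuperAlg.generators]) (by simp [superAug, SuperAlg.generators])
    (by simp [superAug, SuperAlg.generators]) (fun _ _ => rfl) n
end
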